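/- Let T(A) be the twist of A = K[x_{ij}][y^{±1};σ] by the 2-cocycle c, with twist map a ↦ a'. Then: (1) the elements x'_{ij} form a generic q-quantum matrix, i.e., the subalgebra K[x'_{ij}] of T(A) is isomorphic to O_q(M_{m,n−m}) via x'_{ij} ↦ X_{ij}; (2) y' x'_{ij} = q x'_{ij} y' for j < n−m, and y' x'_{i,n−m} = q^{−1} x'_{i,n−m} y'. -/

import Mathlib

open scoped BigOperators

namespace QG

variable (K : Type*) [Field K]

/-- The defining relations of the quantum matrix algebra `O_q(M_{m,n})`. -/
inductive QMatRel (q : K) (m n : ℕ) :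
    FreeAlgebra K (Fin m × Fin n) → FreeAlgebra K (Fin m × Fin n) → Prop
  | row : ∀ (i : Fin m) (j l : Fin n), j < l →
      QMatRel q m n (FreeAlgebra.ι K (i, j) * FreeAlgebra.ι K (i, l))
        (q • (FreeAlgebra.ι K (i, l) * FreeAlgebra.ι K (i, j)))
  | col : ∀ (i k : Fin m) (j : Fin n), i < k →
      QMatRel q m n (FreeAlgebra.ι K (i, j) * FreeAlgebra.ι K (k, j))
        (q • (FreeAlgebra.ι K (k, j) * FreeAlgebra.ι K (i, j)))
  | comm : ∀ (i k : Fin m) (j l : Fin n), k < i → j < l →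
      QMatRel q m n (FreeAlgebra.ι K (i, j) * FreeAlgebra.ι K (k, l))
        (FreeAlgebra.ι K (k, l) * FreeAlgebra.ι K (i, j))
  | qrel : ∀ (i k : Fin m) (j l : Fin n), i < k → j < l →
      QMatRel q m n
        (FreeAlgebra.ι K (i, j) * FreeAlgebra.ι K (k, l) -
          FreeAlgebra.ι K (k, l) * FreeAlgebra.ι K (i, j))
        ((q - q⁻¹) • (FreeAlgebra.ι K (i, l) * FreeAlgebra.ι K (k, j)))

/-- The quantum matrix algebra `O_q(M_{m,n})`. -/
abbrev QMat (q : K) (m n : ℕ) := RingQuot (QMatRel K q m n)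

/-- The generator `X_{ij}` of `O_q(M_{m,n})`. -/
noncomputable def X (q : K) {m n : ℕ} (i : Fin m) (j : Fin n) : QMat K q m n :=
  RingQuot.mkAlgHom K (QMatRel K q m n) (FreeAlgebra.ι K (i, j))

/-- The number of inversions (Coxeter length) of a permutation of `Fin t`. -/
def invCount {t : ℕ} (σ : Equiv.Perm (Fin t)) : ℕ :=
  ((Finset.univ : Finset (Fin t × Fin t)).filter fun p => p.1 < p.2 ∧ σ p.2 < σ p.1).card

/-- The quantum minor `Σ_σ (-q)^{ℓ(σ)} x_{σ(1)1} ⋯ x_{σ(t)t}` of a `t × t`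
matrix of elements of a `K`-algebra. -/
noncomputable def qMinor {A : Type*} [Ring A] [Algebra K A] (q : K) (t : ℕ)
    (x : Fin t → Fin t → A) : A :=
  ∑ σ : Equiv.Perm (Fin t), ((-q) ^ invCount σ) • (List.ofFn fun k => x (σ k) k).prod

/-- The maximal (`m × m`) quantum minor `[J]` of `O_q(M_{m,n})`, with column index set `J`
(columns taken in increasing order, rows `1,…,m`).  (Defined to be `0` if `J` does not
have exactly `m` elements.) -/
noncomputable def grMinor (q : K) (m : ℕ) {n : ℕ} (J : Finset (Fin n)) : QMat K q m n :=
  if h : J.card = m then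
    qMinor K q m (fun i k => X K q i (J.orderEmbOfFin h k)) else 0

/-- The set of maximal quantum minors of `O_q(M_{m,n})`. -/
def grGenSet (q : K) (m n : ℕ) : Set (QMat K q m n) :=
  {a | ∃ J : Finset (Fin n), a = grMinor K q m J}

/-- The quantum grassmannian `O_q(G(m,n))`: the subalgebra of `O_q(M_{m,n})`
generated by the maximal quantum minors. -/
noncomputable def qGrass (q : K) (m n : ℕ) : Subalgebra K (QMat K q m n) :=
  Algebra.adjoin K (grGenSet K q m n)

/-- The maximal quantum minor `[J]` viewed as an element of the quantum grassmannian. -/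
noncomputable def grE (q : K) (m : ℕ) {n : ℕ} (J : Finset (Fin n)) : ↥(qGrass K q m n) :=
  ⟨grMinor K q m J, Algebra.subset_adjoin ⟨J, rfl⟩⟩

/-- Reduction of a natural number modulo `n`, landing in `Fin n` (this encodes the
paper's convention that a column index is read modulo `n`; indices here are 0-based). -/
def fmod (n : ℕ) (hn : 0 < n) (k : ℕ) : Fin n := ⟨k % n, Nat.mod_lt k hn⟩

/-- The index set `{α, α+1, …, α+m-1}` (read modulo `n`) of a consecutive quantum minor
(0-based indices). -/
def consecSet {n : ℕ} (hn : 0 < n) (m : ℕ) (α : ℕ) : Finset (Fin n) :=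
  (Finset.range m).image fun k => fmod n hn (α + k)

end QG
namespace QG

variable (K : Type*) [Field K]

/-- Localisation of a `K`-algebra `A` at the powers of a normal element `u`:
an algebra `B` together with an injective map `A → B` inverting `u`, such that every
element of `B` has the form `a·u^{-k}`. -/
structure NormalLoc (A : Type*) [Ring A] [Algebra K A]
    (B : Type*) [Ring B] [Algebra K B] (u : A) where
  emb : A →ₐ[K] B
  inj : Function.Injective emb
  isUnit : IsUnit (emb u)
  surj : ∀ b : B, ∃ (a : A) (k : ℕ), b = emb a * ↑(isUnit.unit⁻¹ ^ k)

/-- The index set (0-based) of the quantum minor defining the dehomogenisation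
generator `x_{ij}` at the consecutive minor starting at `α`:
`M_α ∪ {~(α+m+j)} ∖ {~(α+(m-1-i))}`. -/
def JxSet {n : ℕ} (hn : 0 < n) (m : ℕ) (α : ℕ) (i : Fin m) (j : Fin (n - m)) :
    Finset (Fin n) :=
  insert (fmod n hn (α + m + j)) ((consecSet hn m α).erase (fmod n hn (α + (m - 1 - i))))

/-- The generator `x_{ij} = [M_α ∪ {~(α+m+j)} ∖ {~(α+(m-1-i))}]·M_α^{-1}` of the
dehomogenisation of the quantum grassmannian at the consecutive minor `M_α`. -/
noncomputable def xElt (q : K) (m n : ℕ) (hn : 0 < n) (α : ℕ)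
    {B : Type*} [Ring B] [Algebra K B]
    (L : NormalLoc K (↥(qGrass K q m n)) B (grE K q m (consecSet hn m α)))
    (i : Fin m) (j : Fin (n - m)) : B :=
  L.emb (grE K q m (JxSet hn m α i j)) * ↑(L.isUnit.unit⁻¹)

/-- `B` is a skew-Laurent extension `R[y^{±1};σ]` of the subalgebra `R`, where `σ` is
conjugation by the unit `y`:  `R` is stable under conjugation by `y` and `B` is free as a
left `R`-module with basis the (integer) powers of `y`. -/
def IsSkewLaurent {B : Type*} [Ring B] [Algebra K B] (R : Subalgebra K B) (y : Bˣ) : Prop :=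
  (∀ r ∈ R, (y : B) * r * ((y⁻¹ : Bˣ) : B) ∈ R) ∧
    ∀ b : B, ∃! f : ℤ →₀ ↥R, b = f.sum fun k r => (r : B) * ((y ^ k : Bˣ) : B)

/-- The quantum minor of a matrix of elements with row index set `R` and column index
set `C` (rows and columns taken in increasing order); `0` if the cardinalities differ. -/
noncomputable def finsetMinor {B : Type*} [Ring B] [Algebra K B] (q : K) {m c : ℕ}
    (x : Fin m → Fin c → B) (R : Finset (Fin m)) (C : Finset (Fin c)) : B :=
  if h : C.card = R.card then
    qMinor K q R.card (fun a b => x (R.orderEmbOfFin rfl a) (C.orderEmbOfFin h b))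
  else 0

/-- The row set `(α+m) − (M_α ∖ I_r)` (0-based) of the image of the maximal minor `[I]`
under the dehomogenisation at `M_α`. -/
def rowSetOf {n : ℕ} (hn : 0 < n) (m : ℕ) (α : ℕ) (I : Finset (Fin n)) : Finset (Fin m) :=
  (Finset.univ.filter fun k : Fin m => fmod n hn (α + k) ∉ I).image Fin.rev

/-- The column set `I_c − (α+m−1)` (0-based) of the image of the maximal minor `[I]`
under the dehomogenisation at `M_α`. -/
def colSetOf {n : ℕ} (hn : 0 < n) (m : ℕ) (α : ℕ) (I : Finset (Fin n)) :
    Finset (Fin (n - m)) :=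
  Finset.univ.filter fun d : Fin (n - m) => fmod n hn (α + m + d) ∈ I

/-- The last index (0-based, corresponding to the paper's index `n`). -/
def lastIdx (n : ℕ) (hn : 0 < n) : Fin n := ⟨n - 1, by omega⟩

/-- The 2-cocycle `c((s_1,…,s_n),(t_1,…,t_n)) = ∏_{j ≠ n} p^{s_n t_j}` on `ℤ^n`. -/
noncomputable def cmap {n : ℕ} (hn : 0 < n) (p : K) :
    (Fin n → ℤ) → (Fin n → ℤ) → K := fun s t =>
  ∏ j ∈ Finset.univ.filter (fun j : Fin n => j ≠ lastIdx n hn),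
    p ^ (s (lastIdx n hn) * t j)

/-- The content `ε(j+m) − ε(m+1−i)` of the dehomogenisation generator `x_{ij}`
(0-based: `ε(m+j) − ε(m-1-i)`). -/
def xContent (m n : ℕ) (i : Fin m) (j : Fin (n - m)) : Fin n → ℤ := fun l =>
  (if (l : ℕ) = m + j then 1 else 0) - (if (l : ℕ) = m - 1 - i then 1 else 0)

/-- The content `ε(1) + ⋯ + ε(m)` of `y` (equivalently, of a consecutive minor `M_1`). -/
def yContent (m n : ℕ) : Fin n → ℤ := fun l => if (l : ℕ) < m then 1 else 0

/-- The content `Σ_{i ∈ I} ε(i)` of a maximal quantum minor `[I]`. -/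
def contentOf {n : ℕ} (I : Finset (Fin n)) : Fin n → ℤ := fun l => if l ∈ I then 1 else 0

/-- A realization of the twist `T(A)` of a `ℤ^n`-graded `K`-algebra `A` by a
2-cocycle `c`: a `K`-algebra `T` together with a `K`-linear isomorphism `τ : A ≃ T`
(the twist map `a ↦ a'`) satisfying `a'b' = c(s,t)·(ab)'` on homogeneous elements. -/
structure CocycleTwist {n : ℕ} (A : Type*) [Ring A] [Algebra K A]
    (𝒜 : (Fin n → ℤ) → Submodule K A) (c : (Fin n → ℤ) → (Fin n → ℤ) → K)
    (T : Type*) [Ring T] [Algebra K T] where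
  τ : A ≃ₗ[K] T
  mul_tw : ∀ (s t : Fin n → ℤ) (a b : A), a ∈ 𝒜 s → b ∈ 𝒜 t →
    τ a * τ b = c s t • τ (a * b)

/-- The image of an index set under the cycle `(1 2 … n)` (0-based). -/
def shiftSet {n : ℕ} (hn : 0 < n) (I : Finset (Fin n)) : Finset (Fin n) :=
  I.image fun a : Fin n => fmod n hn (a.val + 1)

end QG

namespace QGP
set_option linter.unusedVariables false

section Sop
variable {K : Type*} [Field K] {M : Type*} [AddCommGroup M] [Module K M] {m : ℕ}

/-- The Hecke operator. -/
def S (q : K) (f : Fin m → Fin m → M) (i k : Fin m) : M :=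
  if i = k then q • f i k else if i < k then f k i + (q - q⁻¹) • f i k else f k i

/-- The inverse Hecke operator. -/
def S' (q : K) (f : Fin m → Fin m → M) (i k : Fin m) : M :=
  if i = k then q⁻¹ • f i k else if i < k then f k i else f k i - (q - q⁻¹) • f i k

theorem S_S' {q : K} (hq : q ≠ 0) (f : Fin m → Fin m → M) : S q (S' q f) = f := by
  funext i k
  rcases lt_trichotomy i k with h | h | h
  · simp [S, S', h, h.ne, h.ne', h.not_gt]
  · subst h; simp [S, S', smul_smul, hq]
  · simp [S, S', h, h.ne, h.ne', h.not_gt]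

theorem S'_S {q : K} (hq : q ≠ 0) (f : Fin m → Fin m → M) : S' q (S q f) = f := by
  funext i k
  rcases lt_trichotomy i k with h | h | h
  · simp [S, S', h, h.ne, h.ne', h.not_gt]
  · subst h; simp [S, S', smul_smul, hq]
  · simp [S, S', h, h.ne, h.ne', h.not_gt]

theorem S_braid {q : K} (hq : q ≠ 0) (F : Fin m → Fin m → Fin m → M) (i j k : Fin m) :
    S q (fun i j => S q (fun j k => S q (fun i j => F i j k) i j) j k) i j =
    S q (fun j k => S q (fun i j => S q (fun j k => F i j k) j k) i j) j k := by
  rcases lt_trichotomy i j with h1 | h1 | h1 <;> rcases lt_trichotomy j k with h2 | h2 | h2 <;>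
  rcases lt_trichotomy i k with h3 | h3 | h3 <;> first
  | (exfalso; omega)
  | (try subst h1
     try subst h2
     try subst h3
     simp [S, *, ne_of_lt, ne_of_gt, not_lt_of_gt]
     try (match_scalars <;> field_simp <;> ring))

/-- `S` acting on the first two of three indices. -/
def S12 (q : K) (F : Fin m → Fin m → Fin m → M) : Fin m → Fin m → Fin m → M :=
  fun i j k => S q (fun i j => F i j k) i j
/-- `S` acting on the last two of three indices. -/
def S23 (q : K) (F : Fin m → Fin m → Fin m → M) : Fin m → Fin m → Fin m → M :=
  fun i j k => S q (F i) j k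
/-- `S'` acting on the first two of three indices. -/
def S12' (q : K) (F : Fin m → Fin m → Fin m → M) : Fin m → Fin m → Fin m → M :=
  fun i j k => S' q (fun i j => F i j k) i j
/-- `S'` acting on the last two of three indices. -/
def S23' (q : K) (F : Fin m → Fin m → Fin m → M) : Fin m → Fin m → Fin m → M :=
  fun i j k => S' q (F i) j k

theorem S12_S12' {q : K} (hq : q ≠ 0) (F : Fin m → Fin m → Fin m → M) :
    S12 q (S12' q F) = F := by
  funext i j k
  exact congrFun (congrFun (S_S' hq (fun i j => F i j k)) i) j
theorem S12'_S12 {q : K} (hq : q ≠ 0) (F : Fin m → Fin m → Fin m → M) :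
    S12' q (S12 q F) = F := by
  funext i j k
  exact congrFun (congrFun (S'_S hq (fun i j => F i j k)) i) j
theorem S23_S23' {q : K} (hq : q ≠ 0) (F : Fin m → Fin m → Fin m → M) :
    S23 q (S23' q F) = F := by
  funext i j k
  exact congrFun (congrFun (S_S' hq (F i)) j) k
theorem S23'_S23 {q : K} (hq : q ≠ 0) (F : Fin m → Fin m → Fin m → M) :
    S23' q (S23 q F) = F := by
  funext i j k
  exact congrFun (congrFun (S'_S hq (F i)) j) k

theorem braid0 {q : K} (hq : q ≠ 0) (F : Fin m → Fin m → Fin m → M) :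
    S12 q (S23 q (S12 q F)) = S23 q (S12 q (S23 q F)) := by
  funext i j k
  exact S_braid hq F i j k

theorem braid1 {q : K} (hq : q ≠ 0) (F : Fin m → Fin m → Fin m → M) :
    S23 q (S12' q (S23' q F)) = S12' q (S23' q (S12 q F)) := by
  have h := braid0 hq (S12' q (S23' q F))
  rw [S12_S12' hq, S23_S23' hq] at h
  rw [← S12'_S12 hq (S23 q (S12' q (S23' q F))), ← S23'_S23 hq (S12 q (S23 q (S12' q (S23' q F)))),
    ← h]

theorem braid2 {q : K} (hq : q ≠ 0) (F : Fin m → Fin m → Fin m → M) :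
    S12' q (S23' q (S12' q F)) = S23' q (S12' q (S23' q F)) := by
  have h := braid1 hq (S12' q F)
  rw [S12_S12' hq] at h
  rw [← S23'_S23 hq (S12' q (S23' q (S12' q F))), h]

variable {M' : Type*} [AddCommGroup M'] [Module K M']

theorem map_S (q : K) (g : M →ₗ[K] M') (f : Fin m → Fin m → M) (i k : Fin m) :
    g (S q f i k) = S q (fun i k => g (f i k)) i k := by
  unfold S; split_ifs <;> simp
theorem map_S' (q : K) (g : M →ₗ[K] M') (f : Fin m → Fin m → M) (i k : Fin m) :
    g (S' q f i k) = S' q (fun i k => g (f i k)) i k := by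
  unfold S'; split_ifs <;> simp
theorem sum_S {ι : Type*} (s : Finset ι) (q : K) (f : ι → Fin m → Fin m → M) (i k : Fin m) :
    ∑ x ∈ s, S q (f x) i k = S q (fun i k => ∑ x ∈ s, f x i k) i k := by
  unfold S; split_ifs <;> simp [Finset.smul_sum, Finset.sum_add_distrib]
theorem sum_S' {ι : Type*} (s : Finset ι) (q : K) (f : ι → Fin m → Fin m → M) (i k : Fin m) :
    ∑ x ∈ s, S' q (f x) i k = S' q (fun i k => ∑ x ∈ s, f x i k) i k := by
  unfold S'; split_ifs <;> simp [Finset.smul_sum, Finset.sum_sub_distrib]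
theorem S_smul (q c : K) (f : Fin m → Fin m → M) (i k : Fin m) :
    S q (fun i k => c • f i k) i k = c • S q f i k :=
  (map_S q (LinearMap.lsmul K M c) f i k).symm
theorem S'_smul (q c : K) (f : Fin m → Fin m → M) (i k : Fin m) :
    S' q (fun i k => c • f i k) i k = c • S' q f i k :=
  (map_S' q (LinearMap.lsmul K M c) f i k).symm

variable {A : Type*} [Ring A] [Algebra K A]
theorem mul_S (q : K) (a : A) (f : Fin m → Fin m → A) (i k : Fin m) :
    a * S q f i k = S q (fun i k => a * f i k) i k := map_S q (LinearMap.mulLeft K a) f i k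
theorem S_mul (q : K) (a : A) (f : Fin m → Fin m → A) (i k : Fin m) :
    S q f i k * a = S q (fun i k => f i k * a) i k := map_S q (LinearMap.mulRight K a) f i k
theorem mul_S' (q : K) (a : A) (f : Fin m → Fin m → A) (i k : Fin m) :
    a * S' q f i k = S' q (fun i k => a * f i k) i k := map_S' q (LinearMap.mulLeft K a) f i k
theorem S'_mul (q : K) (a : A) (f : Fin m → Fin m → A) (i k : Fin m) :
    S' q f i k * a = S' q (fun i k => f i k * a) i k := map_S' q (LinearMap.mulRight K a) f i k

/-- `S` is a symmetric matrix. -/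
theorem S_symm (q : K) (f g : Fin m → Fin m → A) :
    ∑ a, ∑ b, S q f a b * g a b = ∑ a, ∑ b, f a b * S q g a b := by
  have key : ∀ f : Fin m → Fin m → A, ∀ a b, S q f a b =
      (if a = b then (q-1) • f a b else 0) + (if a < b then (q-q⁻¹) • f a b else 0) + f b a := by
    intro f a b
    rcases lt_trichotomy a b with h | h | h
    · simp [S, h, h.ne, add_comm]
    · subst h; simp [S, sub_smul]
    · simp [S, h.ne', h.not_gt]
  simp only [key, add_mul, mul_add, Finset.sum_add_distrib]
  congr 1
  · congr 1 <;> refine Finset.sum_congr rfl fun a _ => Finset.sum_congr rfl fun b _ => ?_ <;>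
      split_ifs <;> simp
  · exact Finset.sum_comm

end Sop

section QMatS
variable {K : Type*} [Field K] {A : Type*} [Ring A] [Algebra K A] {a b : ℕ}

/-- A matrix of elements satisfying the quantum matrix relations. -/
structure IsQMat (q : K) (x : Fin a → Fin b → A) : Prop where
  row : ∀ i j l, j < l → x i j * x i l = q • (x i l * x i j)
  col : ∀ i k j, i < k → x i j * x k j = q • (x k j * x i j)
  comm : ∀ i k j l, k < i → j < l → x i j * x k l = x k l * x i j
  qrel : ∀ i k j l, i < k → j < l → x i j * x k l - x k l * x i j = (q - q⁻¹) • (x i l * x k j)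

theorem IsQMat.transpose {q : K} {x : Fin a → Fin b → A} (h : IsQMat q x) :
    IsQMat q (fun j i => x i j) where
  row i j l hj := h.col j l i hj
  col i k j hi := h.row j i k hi
  comm i k j l hk hj := (h.comm l j k i hj hk).symm
  qrel i k j l hi hj := by
    rw [h.qrel j l i k hj hi, h.comm l j i k hj hi]

theorem IsQMat.sub {q : K} {x : Fin a → Fin b → A} (h : IsQMat q x) {a' b' : ℕ}
    {f : Fin a' → Fin a} {g : Fin b' → Fin b} (hf : StrictMono f) (hg : StrictMono g) :
    IsQMat q (fun i j => x (f i) (g j)) where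
  row i j l hj := h.row _ _ _ (hg hj)
  col i k j hi := h.col _ _ _ (hf hi)
  comm i k j l hk hj := h.comm _ _ _ _ (hf hk) (hg hj)
  qrel i k j l hi hj := h.qrel _ _ _ _ (hf hi) (hg hj)

theorem IsQMat.scale {q : K} {x : Fin a → Fin b → A} (h : IsQMat q x) (s : Fin a → K) :
    IsQMat q (fun i j => s i • x i j) where
  row i j l hj := by
    simp only [smul_mul_smul_comm, h.row i j l hj]; module
  col i k j hi := by
    simp only [smul_mul_smul_comm, h.col i k j hi]; module
  comm i k j l hk hj := by
    simp only [smul_mul_smul_comm, h.comm i k j l hk hj]; module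
  qrel i k j l hi hj := by
    have := h.qrel i k j l hi hj
    simp only [smul_mul_smul_comm]
    rw [mul_comm (s k) (s i), ← smul_sub, this]; module

theorem IsQMat.map {q : K} {x : Fin a → Fin b → A} (h : IsQMat q x) {C : Type*} [Ring C]
    [Algebra K C] (f : A →ₐ[K] C) : IsQMat q (fun i j => f (x i j)) where
  row i j l hj := by rw [← map_mul, h.row i j l hj]; simp
  col i k j hi := by rw [← map_mul, h.col i k j hi]; simp
  comm i k j l hk hj := by rw [← map_mul, h.comm i k j l hk hj]; simp
  qrel i k j l hi hj := by
    rw [← map_mul, ← map_mul, ← map_sub, h.qrel i k j l hi hj]; simp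

theorem IsQMat.colS {q : K} {x : Fin a → Fin b → A} (h : IsQMat q x) (i k : Fin a)
    (j l : Fin b) (hj : j < l) : x i j * x k l = S q (fun i k => x i l * x k j) i k := by
  rcases lt_trichotomy i k with hi | hi | hi
  · simp only [S, hi, hi.ne, if_true, if_false]
    rw [← h.qrel i k j l hi hj]; abel
  · subst hi; simp [S, h.row i j l hj]
  · simp only [S, hi.ne', hi.not_gt, if_false]
    exact h.comm _ _ _ _ hi hj

theorem IsQMat.colSS {q : K} (hq : q ≠ 0) {x : Fin a → Fin b → A} (h : IsQMat q x) (i k : Fin a)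
    (j : Fin b) : S q (fun i k => x i j * x k j) i k = q • (x i j * x k j) := by
  rcases lt_trichotomy i k with hi | hi | hi
  · simp only [S, hi, hi.ne, if_true, if_false]
    rw [h.col i k j hi]
    match_scalars; field_simp; ring
  · subst hi; simp [S]
  · simp only [S, hi.ne', hi.not_gt, if_false]
    exact h.col _ _ _ hi

theorem IsQMat.ofS {q : K} (hq : q ≠ 0) {x : Fin a → Fin b → A}
    (h1 : ∀ i k j l, j < l → x i j * x k l = S q (fun i k => x i l * x k j) i k)
    (h2 : ∀ i k j, S q (fun i k => x i j * x k j) i k = q • (x i j * x k j)) : IsQMat q x where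
  row i j l hj := by simpa [S] using h1 i i j l hj
  col i k j hi := by
    have := h2 k i j
    simpa [S, hi.ne', hi.not_gt] using this
  comm i k j l hk hj := by
    have := h1 i k j l hj
    simpa [S, hk.ne', hk.not_gt] using this
  qrel i k j l hi hj := by
    have := h1 i k j l hj
    simp only [S, hi, hi.ne, if_true, if_false] at this
    rw [this]; abel

theorem IsQMat.rtt {q : K} (hq : q ≠ 0) {x : Fin a → Fin b → A} (h : IsQMat q x) (i k : Fin a)
    (j l : Fin b) : S q (fun i k => x i j * x k l) i k = S q (fun j l => x i j * x k l) j l := by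
  have e : ∀ j l, j < l → (fun i k => x i j * x k l) = S q (fun i k => x i l * x k j) := by
    intro j l hj; funext i k; exact h.colS i k j l hj
  have e' : ∀ (f : Fin a → Fin a → A) i k, S q (S q f) i k = (q - q⁻¹) • S q f i k + f i k := by
    intro f i k
    rcases lt_trichotomy i k with hi | hi | hi
    · simp [S, hi, hi.ne, hi.ne', hi.not_gt]; abel
    · subst hi; simp only [S, if_true]; match_scalars; field_simp; ring
    · simp [S, hi, hi.ne, hi.ne', hi.not_gt]; abel
  rcases lt_trichotomy j l with hj | hj | hj
  · conv_rhs => simp only [S, hj, hj.ne, if_true, if_false]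
    rw [e j l hj, e', h.colS i k j l hj]; abel
  · subst hj
    rw [h.colSS hq]; simp [S]
  · conv_rhs => simp only [S, hj.ne', hj.not_gt, if_false]
    rw [h.colS i k l j hj]

theorem IsQMat.ofRtt {q : K} (hq : q ≠ 0) {x : Fin a → Fin b → A}
    (h : ∀ i k j l, S q (fun i k => x i j * x k l) i k = S q (fun j l => x i j * x k l) j l) :
    IsQMat q x := by
  refine IsQMat.ofS hq (fun i k j l hj => ?_) (fun i k j => ?_)
  · have := h i k l j
    simp only [S, hj.ne', hj.not_gt, if_false] at this
    simp only [S]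
    exact this.symm
  · rw [h]; simp [S]

/-- Contraction with a quantum matrix commutes with `S`. -/
theorem IsQMat.contract {q : K} (hq : q ≠ 0) {z : Fin a → Fin b → A} (h : IsQMat q z)
    (g : Fin b → Fin b → A) (r s : Fin a) :
    ∑ c, ∑ d, z r c * z s d * S q g c d =
      S q (fun r s => ∑ c, ∑ d, z r c * z s d * g c d) r s := by
  rw [← S_symm q (fun c d => z r c * z s d) g, ← sum_S]
  refine Finset.sum_congr rfl fun c _ => ?_
  rw [← sum_S]
  refine Finset.sum_congr rfl fun d _ => ?_
  rw [← h.rtt hq, S_mul]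

theorem IsQMat.contract' {q : K} (hq : q ≠ 0) {z : Fin a → Fin b → A} (h : IsQMat q z)
    (g : Fin b → Fin b → A) (r s : Fin a) :
    ∑ c, ∑ d, z r c * z s d * S' q g c d =
      S' q (fun r s => ∑ c, ∑ d, z r c * z s d * g c d) r s := by
  have := fun r s => h.contract hq (S' q g) r s
  rw [S_S' hq] at this
  have e : (fun r s => ∑ c, ∑ d, z r c * z s d * g c d) =
    S q (fun r s => ∑ c, ∑ d, z r c * z s d * S' q g c d) := by
    funext r s; exact this r s
  rw [e, S'_S hq]

end QMatS
end QGP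

namespace QGP
set_option linter.unusedVariables false

section Words
variable {K : Type*} [Field K]

/-- Antisymmetric (q-version) function on words. -/
structure Anti {ι M : Type*} [LinearOrder ι] [AddCommGroup M] [Module K M] (q : K)
    (φ : List ι → M) : Prop where
  rep : ∀ p s a, φ (p ++ a :: a :: s) = 0
  swap : ∀ p s a b, a < b → φ (p ++ b :: a :: s) = (-q) • φ (p ++ a :: b :: s)

/-- Two-letter weight. -/
def th {ι : Type*} [LinearOrder ι] (q : K) (a b : ι) : K :=
  if a = b then 0 else if a < b then 1 else -q

/-- The weight of a word. -/
def om {ι : Type*} [LinearOrder ι] (q : K) : List ι → K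
  | [] => 1
  | a :: s => (s.map (th q a)).prod * om q s

variable {ι : Type*} [LinearOrder ι] {M : Type*} [AddCommGroup M] [Module K M]

theorem Anti.cons {q : K} {φ : List ι → M} (h : Anti q φ) (a : ι) :
    Anti q (fun s => φ (a :: s)) where
  rep p s b := h.rep (a :: p) s b
  swap p s b c hb := h.swap (a :: p) s b c hb

theorem om_append (q : K) (p s : List ι) :
    om q (p ++ s) = om q p * om q s * (p.map (fun a => (s.map (th q a)).prod)).prod := by
  induction p with
  | nil => simp [om]
  | cons a p ih => simp [om, ih]; ring

theorem om_anti (q : K) : Anti q (om q : List ι → K) where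
  rep p s a := by simp [om_append, om, th]
  swap p s a b hab := by
    simp only [om_append, om, th, List.map_cons, List.prod_cons, hab.ne, hab.ne', hab, hab.not_gt,
      if_true, if_false, smul_eq_mul]
    have : (p.map (fun c => th q c b * (th q c a * (s.map (th q c)).prod))).prod
      = (p.map (fun c => th q c a * (th q c b * (s.map (th q c)).prod))).prod := by
      congr 2; funext c; ring
    simp only [th] at this
    rw [this]
    ring

theorem anti_insert {q : K} {φ : List ι → M} (h : Anti q φ) (a : ι) (s : List ι)
    (hs : s.Pairwise (· < ·)) :
    φ (a :: s) = (s.map (th q a)).prod • φ (s.orderedInsert (· ≤ ·) a) := by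
  induction s generalizing φ with
  | nil => simp
  | cons b s ih =>
    rcases lt_trichotomy a b with hab | hab | hab
    · have h1 : (s.map (th q a)).prod = 1 := by
        apply List.prod_eq_one
        intro x hx
        obtain ⟨c, hc, rfl⟩ := List.mem_map.1 hx
        have : a < c := hab.trans ((List.pairwise_cons.1 hs).1 c hc)
        simp [th, this, this.ne]
      simp [hab.le, h1, th, hab, hab.ne]
    · subst hab
      have := h.rep [] s a
      simp only [List.nil_append] at this
      simp [this, th]
    · have h2 := h.swap [] s b a hab
      simp only [List.nil_append] at h2
      rw [h2, ih (h.cons b) (List.pairwise_cons.1 hs).2]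
      simp [hab.not_ge, th, hab.ne', hab.not_gt, smul_smul]

theorem om_of_dup (q : K) (J : List ι) (h : ¬ J.Nodup) : om q J = 0 := by
  induction J with
  | nil => simp at h
  | cons a s ih =>
    rw [List.nodup_cons, not_and_or, not_not] at h
    rcases h with h | h
    · have : (s.map (th q a)).prod = 0 := by
        apply List.prod_eq_zero
        exact List.mem_map.2 ⟨a, h, by simp [th]⟩
      simp [om, this]
    · simp [om, ih h]

theorem anti_zero {q : K} {φ : List ι → M} (h : Anti q φ) (J : List ι) (hJ : ¬ J.Nodup) :
    φ J = 0 := by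
  suffices H : ∀ (n : ℕ) (J : List ι) (φ : List ι → M), J.length = n → Anti q φ →
      (J.Nodup → φ J = om q J • φ (J.insertionSort (· ≤ ·))) ∧ (¬ J.Nodup → φ J = 0) from
    (H _ J φ rfl h).2 hJ
  intro n
  induction n with
  | zero =>
    intro J φ hl hφ
    obtain rfl := List.length_eq_zero_iff.1 hl
    simp [om]
  | succ n ih =>
    intro J φ hl hφ
    obtain ⟨a, s, rfl⟩ : ∃ a s, J = a :: s := by
      cases J with
      | nil => simp at hl
      | cons a s => exact ⟨a, s, rfl⟩
    have hl' : s.length = n := by simpa using hl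
    obtain ⟨i1, i2⟩ := ih s (fun s => φ (a :: s)) hl' (hφ.cons a)
    have key : s.Nodup → φ (a :: s) = om q s • (s.map (th q a)).prod •
        φ ((a :: s).insertionSort (· ≤ ·)) := by
      intro hs
      have hsort : (s.insertionSort (· ≤ ·)).Pairwise (· < ·) := by
        have h1 := List.pairwise_insertionSort (· ≤ ·) s
        have h2 : (s.insertionSort (· ≤ ·)).Nodup := (List.perm_insertionSort _ s).nodup_iff.2 hs
        exact (h1.and h2).imp (fun h => lt_of_le_of_ne h.1 h.2)
      rw [i1 hs, anti_insert hφ a _ hsort, List.insertionSort_cons]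
      congr 2
      exact ((List.perm_insertionSort (· ≤ ·) s).map _).prod_eq
    constructor
    · intro hd
      rw [key (List.nodup_cons.1 hd).2, smul_smul, mul_comm]; rfl
    · intro hd
      by_cases hs : s.Nodup
      · rw [key hs, smul_smul, mul_comm]
        have : om q (a :: s) = 0 := om_of_dup q _ hd
        rw [om] at this
        rw [this, zero_smul]
      · exact i2 hs

theorem anti_sort {q : K} {φ : List ι → M} (h : Anti q φ) (J : List ι) :
    φ J = om q J • φ (J.insertionSort (· ≤ ·)) := by
  induction J generalizing φ with
  | nil => simp [om]
  | cons a s ih =>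
    by_cases hd : (a :: s).Nodup
    · have hs := (List.nodup_cons.1 hd).2
      have hsort : (s.insertionSort (· ≤ ·)).Pairwise (· < ·) := by
        have h1 := List.pairwise_insertionSort (· ≤ ·) s
        have h2 : (s.insertionSort (· ≤ ·)).Nodup := (List.perm_insertionSort _ s).nodup_iff.2 hs
        exact (h1.and h2).imp (fun h => lt_of_le_of_ne h.1 h.2)
      have e := ih (h.cons a)
      rw [e, anti_insert h a _ hsort, List.insertionSort_cons, smul_smul, om, mul_comm]
      congr 2
      exact ((List.perm_insertionSort (· ≤ ·) s).map _).prod_eq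
    · rw [anti_zero h _ hd, om_of_dup q _ hd, zero_smul]

theorem anti_full {N : ℕ} {q : K} {φ : List (Fin N) → M} (h : Anti q φ) (J : List (Fin N))
    (hl : J.length = N) : φ J = om q J • φ (List.finRange N) := by
  by_cases hd : J.Nodup
  · rw [anti_sort h J]
    congr 2
    have hp : (J.insertionSort (· ≤ ·)).Perm (List.finRange N) := by
      refine (List.perm_insertionSort _ _).trans ?_
      refine (List.perm_ext_iff_of_nodup hd (List.nodup_finRange N)).2 fun a => ?_
      simp only [List.mem_finRange, iff_true]
      have h1 : J.toFinset = Finset.univ := by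
        apply Finset.eq_univ_of_card
        rw [List.toFinset_card_of_nodup hd, hl, Fintype.card_fin]
      have : a ∈ J.toFinset := by rw [h1]; simp
      simpa using this
    exact hp.eq_of_pairwise' (List.pairwise_insertionSort (· ≤ ·) J)
      ((List.pairwise_lt_finRange N).imp le_of_lt)
  · rw [anti_zero h _ hd, om_of_dup q _ hd, zero_smul]

end Words

section Pair
variable {K : Type*} [Field K] {A : Type*} [Ring A] [Algebra K A] {N : ℕ}

/-- Pairing of a functional on words with a list of vectors. -/
def pair (φ : List (Fin N) → K) : List (Fin N → A) → A
  | [] => φ [] • 1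
  | c :: cs => ∑ r, c r * pair (fun s => φ (r :: s)) cs

theorem pair_smul (k : K) (φ : List (Fin N) → K) (cs : List (Fin N → A)) :
    pair (fun s => k * φ s) cs = k • pair φ cs := by
  induction cs generalizing φ with
  | nil => simp [pair, mul_smul]
  | cons c cs ih => simp [pair, ih, Finset.smul_sum]

theorem pair_zero (cs : List (Fin N → A)) : pair (fun _ => (0 : K)) cs = 0 := by
  simpa using pair_smul (0 : K) (fun _ => 0) cs

theorem pair_snoc (φ : List (Fin N) → K) (cs : List (Fin N → A)) (w : Fin N → A) :
    pair φ (cs ++ [w]) = ∑ r, pair (fun s => φ (s ++ [r])) cs * w r := by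
  induction cs generalizing φ with
  | nil => simp [pair]
  | cons c cs ih =>
    simp only [List.cons_append, pair, ih, Finset.mul_sum, Finset.sum_mul, mul_assoc]
    exact Finset.sum_comm

theorem pair_rep2 {q : K} {b : ℕ} {x : Fin N → Fin b → A} (hx : IsQMat q x)
    {φ : List (Fin N) → K} (h : Anti q φ) (j : Fin b) (cs : List (Fin N → A)) :
    pair φ ((fun r => x r j) :: (fun r => x r j) :: cs) = 0 := by
  simp only [pair, Finset.mul_sum, ← mul_assoc]
  have key : ∀ r s, r < s → x r j * x s j * pair (fun t => φ (r :: s :: t)) cs +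
      x s j * x r j * pair (fun t => φ (s :: r :: t)) cs = 0 := by
    intro r s hrs
    have : (fun t => φ (s :: r :: t)) = fun t => (-q) * φ (r :: s :: t) := by
      funext t; exact h.swap [] t r s hrs
    rw [this, pair_smul, hx.col r s j hrs]
    simp
  have hd : ∀ r, x r j * x r j * pair (fun t => φ (r :: r :: t)) cs = 0 := by
    intro r
    have : (fun t => φ (r :: r :: t)) = fun t => 0 := by
      funext t; exact h.rep [] t r
    rw [this, pair_zero, mul_zero]
  rw [← Finset.sum_product']
  refine Finset.sum_involution (fun p _ => (p.2, p.1)) ?_ ?_ ?_ ?_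
  · rintro ⟨r, s⟩ _
    rcases lt_trichotomy r s with hrs | hrs | hrs
    · exact key r s hrs
    · subst hrs; simp [hd]
    · rw [add_comm]; exact key s r hrs
  · rintro ⟨r, s⟩ _ hne heq
    simp only [Prod.mk.injEq] at heq
    obtain ⟨rfl, _⟩ := heq
    exact hne (hd _)
  · simp
  · simp

theorem pair_swap2 {q : K} (hq : q ≠ 0) {b : ℕ} {x : Fin N → Fin b → A} (hx : IsQMat q x)
    {φ : List (Fin N) → K} (h : Anti q φ) (j l : Fin b) (hj : j < l) (cs : List (Fin N → A)) :
    pair φ ((fun r => x r l) :: (fun r => x r j) :: cs) =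
      (-q) • pair φ ((fun r => x r j) :: (fun r => x r l) :: cs) := by
  simp only [pair, Finset.mul_sum, ← mul_assoc]
  rw [← sub_eq_zero]
  simp only [Finset.smul_sum, ← Finset.sum_sub_distrib]
  have key : ∀ r s, r < s → (x r l * x s j * pair (fun t => φ (r :: s :: t)) cs
      - (-q) • (x r j * x s l * pair (fun t => φ (r :: s :: t)) cs)) +
      (x s l * x r j * pair (fun t => φ (s :: r :: t)) cs 
      - (-q) • (x s j * x r l * pair (fun t => φ (s :: r :: t)) cs)) = 0 := by
    intro r s hrs
    have : (fun t => φ (s :: r :: t)) = fun t => (-q) * φ (r :: s :: t) := by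
      funext t; exact h.swap [] t r s hrs
    rw [this, pair_smul]
    have e1 : x r j * x s l = x s l * x r j + (q - q⁻¹) • (x r l * x s j) := by
      rw [← hx.qrel r s j l hrs hj]; abel
    have e2 := hx.comm s r j l hrs hj
    rw [e1, e2, add_mul]
    simp only [smul_mul_assoc, mul_smul_comm]
    match_scalars
    · field_simp; ring
    · ring
  have hd : ∀ r, x r l * x r j * pair (fun t => φ (r :: r :: t)) cs - 
      (-q) • (x r j * x r l * pair (fun t => φ (r :: r :: t)) cs) = 0 := by
    intro r
    have : (fun t => φ (r :: r :: t)) = fun t => 0 := by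
      funext t; exact h.rep [] t r
    rw [this, pair_zero, mul_zero, mul_zero, smul_zero, sub_zero]
  rw [← Finset.sum_product']
  refine Finset.sum_involution (fun p _ => (p.2, p.1)) ?_ ?_ ?_ ?_
  · rintro ⟨r, s⟩ _
    rcases lt_trichotomy r s with hrs | hrs | hrs
    · exact key r s hrs
    · subst hrs; simp only [hd]; simp
    · rw [add_comm]; exact key s r hrs
  · rintro ⟨r, s⟩ _ hne heq
    simp only [Prod.mk.injEq] at heq
    obtain ⟨rfl, _⟩ := heq
    exact hne (hd _)
  · simp
  · simp

theorem pair_anti {q : K} (hq : q ≠ 0) {b : ℕ} {x : Fin N → Fin b → A} (hx : IsQMat q x)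
    {φ : List (Fin N) → K} (h : Anti q φ) :
    Anti q (fun J : List (Fin b) => pair φ (J.map fun j r => x r j)) where
  rep p s a := by
    induction p generalizing φ with
    | nil => exact pair_rep2 hx h a _
    | cons c p ih =>
      simp only [List.cons_append, List.map_cons, pair]
      exact Finset.sum_eq_zero fun r _ => by rw [ih (h.cons r), mul_zero]
  swap p s a b' hab := by
    induction p generalizing φ with
    | nil => exact pair_swap2 hq hx h a b' hab _
    | cons c p ih =>
      simp only [List.cons_append, List.map_cons, pair, Finset.smul_sum]
      exact Finset.sum_congr rfl fun r _ => by rw [ih (h.cons r), mul_smul_comm]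

theorem pair_ofFn (φ : List (Fin N) → K) {t : ℕ} (cs : Fin t → Fin N → A) :
    pair φ (List.ofFn cs) =
      ∑ s : Fin t → Fin N, φ (List.ofFn s) • (List.ofFn fun k => cs k (s k)).prod := by
  induction t generalizing φ with
  | zero => simp [pair]
  | succ t ih =>
    rw [List.ofFn_succ, pair, ← (Fin.consEquiv (fun _ : Fin (t+1) => Fin N)).sum_comp,
      Fintype.sum_prod_type]
    refine Finset.sum_congr rfl fun r _ => ?_
    rw [ih, Finset.mul_sum]
    refine Finset.sum_congr rfl fun s _ => ?_
    simp [Fin.consEquiv, List.ofFn_succ, Fin.cons_succ, Fin.cons_zero]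

end Pair
end QGP

namespace QGP
set_option linter.unusedVariables false
open QG

section Minor
variable {K : Type*} [Field K] {A : Type*} [Ring A] [Algebra K A]

theorem om_ofFn (q : K) {ι : Type*} [LinearOrder ι] {t : ℕ} (f : Fin t → ι) :
    om q (List.ofFn f) = ∏ k, ∏ l, if k < l then th q (f k) (f l) else 1 := by
  induction t with
  | zero => simp [om]
  | succ t ih =>
    rw [List.ofFn_succ, om, ih, Fin.prod_univ_succ]
    congr 1
    · rw [Fin.prod_univ_succ, List.map_ofFn, List.prod_ofFn]
      simp
    · refine Finset.prod_congr rfl fun k _ => ?_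
      rw [Fin.prod_univ_succ]
      simp

theorem om_perm (q : K) {t : ℕ} (σ : Equiv.Perm (Fin t)) :
    om q (List.ofFn σ) = (-q) ^ invCount σ := by
  rw [om_ofFn, invCount, ← Finset.prod_const, Finset.prod_filter, ← Finset.univ_product_univ,
    Finset.prod_product]
  refine Finset.prod_congr rfl fun k _ => Finset.prod_congr rfl fun l _ => ?_
  by_cases h : k < l
  · have hne : σ k ≠ σ l := fun e => h.ne (σ.injective e)
    rcases lt_or_gt_of_ne hne with h2 | h2
    · simp [h, th, hne, h2, h2.not_gt]
    · simp [h, th, hne, h2, h2.not_gt]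
  · simp [h]

theorem om_mono (q : K) {ι κ : Type*} [LinearOrder ι] [LinearOrder κ] {t : ℕ} (f : Fin t → ι)
    {g : ι → κ} (hg : StrictMono g) :
    om q (List.ofFn (fun k => g (f k))) = om q (List.ofFn f) := by
  simp only [om_ofFn, th, hg.lt_iff_lt, hg.injective.eq_iff]

theorem qMinor_eq_pair (q : K) (t : ℕ) (x : Fin t → Fin t → A) :
    qMinor K q t x = pair (om q) (List.ofFn fun k r => x r k) := by
  rw [pair_ofFn, qMinor]
  refine Fintype.sum_of_injective (fun σ : Equiv.Perm (Fin t) => (σ : Fin t → Fin t))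
    DFunLike.coe_injective _ _ ?_ ?_
  · intro s hs
    rw [om_of_dup, zero_smul]
    rw [List.nodup_ofFn]
    intro hinj
    exact hs ⟨Equiv.ofBijective s (Finite.injective_iff_bijective.1 hinj), rfl⟩
  · intro σ
    simp only [om_perm]

/-- Normalising scalars. -/
def kap (q : K) {t : ℕ} (r : Fin (t + 1)) : K := ∏ k : Fin t, th q (r.succAbove k) r
/-- Normalising scalars. -/
def kap' (q : K) {t : ℕ} (r : Fin (t + 1)) : K := ∏ k : Fin t, th q r (r.succAbove k)

theorem th_ne_zero {q : K} (hq : q ≠ 0) {ι : Type*} [LinearOrder ι] {a b : ι} (h : a ≠ b) :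
    th q a b ≠ 0 := by
  unfold th; split_ifs <;> simp_all

theorem th_mul_th (q : K) {ι : Type*} [LinearOrder ι] {a b : ι} (h : a ≠ b) :
    th q a b * th q b a = -q := by
  rcases lt_or_gt_of_ne h with h2 | h2 <;> simp [th, h, h.symm, h2, h2.not_gt]

theorem kap_ne_zero {q : K} (hq : q ≠ 0) {t : ℕ} (r : Fin (t + 1)) : kap q r ≠ 0 :=
  Finset.prod_ne_zero_iff.2 fun k _ => th_ne_zero hq (Fin.succAbove_ne r k)
theorem kap'_ne_zero {q : K} (hq : q ≠ 0) {t : ℕ} (r : Fin (t + 1)) : kap' q r ≠ 0 :=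
  Finset.prod_ne_zero_iff.2 fun k _ => th_ne_zero hq (Fin.succAbove_ne r k).symm
theorem kap_mul_kap' (q : K) {t : ℕ} (r : Fin (t + 1)) : kap q r * kap' q r = (-q) ^ t := by
  rw [kap, kap', ← Finset.prod_mul_distrib, Finset.prod_congr rfl fun k _ =>
    th_mul_th q (Fin.succAbove_ne r k)]
  simp

theorem sum_succAbove {t : ℕ} (r : Fin (t + 1)) (g : (Fin t → Fin (t + 1)) → A)
    (hg : ∀ s, (¬ Function.Injective s ∨ ∃ k, s k = r) → g s = 0) :
    ∑ σ : Equiv.Perm (Fin t), g (fun k => r.succAbove (σ k)) = ∑ s, g s := by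
  refine Fintype.sum_of_injective
    (fun σ : Equiv.Perm (Fin t) => (fun k => r.succAbove (σ k) : Fin t → Fin (t + 1)))
    ?_ _ _ ?_ (fun _ => rfl)
  · intro σ τ h
    exact Equiv.ext fun k => by simpa using congrFun h k
  · intro s hs
    apply hg
    by_contra hc
    push Not at hc
    obtain ⟨hinj, hr⟩ := hc
    choose f hf using fun k => Fin.exists_succAbove_eq (hr k)
    have hfi : Function.Injective f := by
      intro a b hab
      apply hinj
      rw [← hf a, ← hf b, hab]
    exact hs ⟨Equiv.ofBijective f (Finite.injective_iff_bijective.1 hfi), funext hf⟩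

theorem pair_snoc_minor (q : K) {t : ℕ} (r : Fin (t + 1)) (cs : Fin t → Fin (t + 1) → A) :
    pair (fun s => om q (s ++ [r])) (List.ofFn cs) =
      kap q r • qMinor K q t (fun i k => cs k (r.succAbove i)) := by
  rw [pair_ofFn, ← sum_succAbove r, qMinor, Finset.smul_sum]
  · refine Finset.sum_congr rfl fun σ _ => ?_
    rw [smul_smul]
    congr 1
    rw [om_append, om_mono q σ (Fin.strictMono_succAbove r), om_perm]
    simp only [om, List.map_nil, List.prod_nil, List.map_cons, List.prod_cons, mul_one,
      List.map_ofFn, List.prod_ofFn, Function.comp_def]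
    rw [mul_comm, kap]
    congr 1
    exact Equiv.prod_comp σ (fun k => th q (r.succAbove k) r)
  · intro s hs
    rw [om_of_dup, zero_smul]
    intro hd
    rw [List.nodup_append] at hd
    rcases hs with hs | ⟨k, hk⟩
    · exact hs (List.nodup_ofFn.1 hd.1)
    · refine hd.2.2 (s k) ?_ r ?_ hk
      · exact List.mem_ofFn.2 ⟨k, rfl⟩
      · simp

theorem pair_cons_minor (q : K) {t : ℕ} (r : Fin (t + 1)) (cs : Fin t → Fin (t + 1) → A) :
    pair (fun s => om q (r :: s)) (List.ofFn cs) =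
      kap' q r • qMinor K q t (fun i k => cs k (r.succAbove i)) := by
  rw [pair_ofFn, ← sum_succAbove r, qMinor, Finset.smul_sum]
  · refine Finset.sum_congr rfl fun σ _ => ?_
    rw [smul_smul]
    congr 1
    rw [om, om_mono q σ (Fin.strictMono_succAbove r), om_perm]
    simp only [List.map_ofFn, List.prod_ofFn, Function.comp_def]
    rw [kap']
    congr 1
    exact Equiv.prod_comp σ (fun k => th q r (r.succAbove k))
  · intro s hs
    rw [om_of_dup, zero_smul]
    intro hd
    rw [List.nodup_cons] at hd
    rcases hs with hs | ⟨k, hk⟩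
    · exact hs (List.nodup_ofFn.1 hd.2)
    · exact hd.1 (List.mem_ofFn.2 ⟨k, hk⟩)

/-- Sorting by rows does not change the product. -/
theorem prod_insert {q : K} {a b : ℕ} {x : Fin a → Fin b → A} (hx : IsQMat q x)
    (p : Fin a × Fin b) (L : List (Fin a × Fin b)) (h1 : ∀ p' ∈ L, p.2 < p'.2) :
    ((L.orderedInsert (fun p p' => p.1 ≤ p'.1) p).map (fun p => x p.1 p.2)).prod =
      x p.1 p.2 * (L.map (fun p => x p.1 p.2)).prod := by
  induction L with
  | nil => simp
  | cons p' L ih =>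
    by_cases h : p.1 ≤ p'.1
    · simp [h]
    · simp only [List.orderedInsert, h, if_false, List.map_cons, List.prod_cons]
      rw [ih (fun p'' hp => h1 p'' (List.mem_cons_of_mem _ hp)), ← mul_assoc, ← mul_assoc,
        hx.comm p.1 p'.1 p.2 p'.2 (not_le.1 h) (h1 p' List.mem_cons_self)]

theorem prod_sort {q : K} {a b : ℕ} {x : Fin a → Fin b → A} (hx : IsQMat q x)
    (L : List (Fin a × Fin b)) (h1 : L.Pairwise (fun p p' => p.2 < p'.2)) :
    ((L.insertionSort (fun p p' => p.1 ≤ p'.1)).map (fun p => x p.1 p.2)).prod =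
      (L.map (fun p => x p.1 p.2)).prod := by
  induction L with
  | nil => simp
  | cons p L ih =>
    rw [List.pairwise_cons] at h1
    rw [List.insertionSort_cons, prod_insert hx, ih h1.2, List.map_cons, List.prod_cons]
    intro p' hp'
    exact h1.1 p' ((List.perm_insertionSort _ L).mem_iff.1 hp')

theorem prod_perm_eq {q : K} {t : ℕ} {x : Fin t → Fin t → A} (hx : IsQMat q x)
    (σ : Equiv.Perm (Fin t)) : (List.ofFn fun k => x (σ k) k).prod =
      (List.ofFn fun k => x k (σ⁻¹ k)).prod := by
  have hL := prod_sort hx (List.ofFn fun k => (σ k, k)) (by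
    rw [List.pairwise_ofFn]; intro i j hij; exact hij)
  have e : (List.ofFn fun k => (σ k, k)).insertionSort (fun p p' => p.1 ≤ p'.1) =
      List.ofFn fun k => (k, σ⁻¹ k) := by
    have hperm : ((List.ofFn fun k => (σ k, k)).insertionSort (fun p p' => p.1 ≤ p'.1)).Perm
        (List.ofFn fun k => (k, σ⁻¹ k)) := by
      refine (List.perm_insertionSort _ _).trans ?_
      refine (List.perm_ext_iff_of_nodup ?_ ?_).2 ?_
      · rw [List.nodup_ofFn]; intro a b h; simpa using h
      · rw [List.nodup_ofFn]; intro a b h; simpa using h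
      · rintro ⟨u, v⟩
        simp only [List.mem_ofFn, Prod.mk.injEq]
        constructor
        · rintro ⟨k, rfl, rfl⟩; exact ⟨σ k, by simp⟩
        · rintro ⟨k, rfl, rfl⟩; exact ⟨σ⁻¹ k, by simp⟩
    refine List.Perm.eq_of_pairwise ?_ ?_ ?_ hperm (le := fun p p' : Fin t × Fin t => p.1 ≤ p'.1)
    · rintro p p' hp hp' h1 h2
      have h3 := hperm.mem_iff.1 hp
      have h4 := hp'
      simp only [List.mem_ofFn] at h3 h4
      obtain ⟨k, rfl⟩ := h3
      obtain ⟨l, rfl⟩ := h4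
      have : k = l := le_antisymm h1 h2
      rw [this]
    · haveI : Std.Total (fun p p' : Fin t × Fin t => p.1 ≤ p'.1) := ⟨fun a b => le_total _ _⟩
      haveI : IsTrans (Fin t × Fin t) (fun p p' => p.1 ≤ p'.1) := ⟨fun a b c => le_trans⟩
      exact List.pairwise_insertionSort _ _
    · rw [List.pairwise_ofFn]; intro i j hij; exact hij.le
  rw [e] at hL
  simp only [List.map_ofFn, Function.comp_def] at hL
  exact hL.symm

theorem invCount_inv {t : ℕ} (σ : Equiv.Perm (Fin t)) : invCount σ⁻¹ = invCount σ := by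
  unfold invCount
  refine Finset.card_bij' (fun p _ => (σ⁻¹ p.2, σ⁻¹ p.1)) (fun p _ => (σ p.2, σ p.1)) ?_ ?_ ?_ ?_
  · rintro ⟨a, b⟩ h; simp at h ⊢; exact h.symm
  · rintro ⟨a, b⟩ h; simp at h ⊢; exact h.symm
  · rintro ⟨a, b⟩ h; simp
  · rintro ⟨a, b⟩ h; simp

theorem qMinor_transpose {q : K} {t : ℕ} {x : Fin t → Fin t → A} (hx : IsQMat q x) :
    qMinor K q t (fun i j => x j i) = qMinor K q t x := by
  unfold qMinor
  rw [← Equiv.sum_comp (Equiv.inv (Equiv.Perm (Fin t)))]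
  refine Finset.sum_congr rfl fun σ _ => ?_
  simp only [Equiv.inv_apply]
  rw [invCount_inv, prod_perm_eq hx]

/-- The quantum adjugate. -/
noncomputable def adj (q : K) {t : ℕ} (x : Fin (t + 1) → Fin (t + 1) → A) (a r : Fin (t + 1)) : A :=
  ((kap q a)⁻¹ * kap q r) • qMinor K q t (fun i k => x (r.succAbove i) (a.succAbove k))

theorem adj_mul (q : K) {t : ℕ} (x : Fin (t + 1) → Fin (t + 1) → A) (a : Fin (t + 1))
    (w : Fin (t + 1) → A) :
    ∑ r, adj q x a r * w r =
      (kap q a)⁻¹ • pair (om q) ((List.ofFn fun k r => x r (a.succAbove k)) ++ [w]) := by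
  rw [pair_snoc, Finset.smul_sum]
  refine Finset.sum_congr rfl fun r _ => ?_
  rw [pair_snoc_minor, adj, mul_smul, smul_mul_assoc]

theorem mul_adj {q : K} (hq : q ≠ 0) {t : ℕ} {x : Fin (t + 1) → Fin (t + 1) → A} (hx : IsQMat q x)
    (r : Fin (t + 1)) (w : Fin (t + 1) → A) :
    ∑ a, w a * adj q x a r =
      (kap' q r)⁻¹ • pair (om q) (w :: (List.ofFn fun k a => x (r.succAbove k) a)) := by
  rw [pair, Finset.smul_sum]
  refine Finset.sum_congr rfl fun a _ => ?_
  rw [pair_cons_minor, adj]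
  have h1 := qMinor_transpose (hx.sub (Fin.strictMono_succAbove r) (Fin.strictMono_succAbove a))
  rw [h1, mul_smul_comm, mul_smul_comm, smul_smul]
  congr 1
  have h2 := kap_mul_kap' q r
  have h3 := kap_mul_kap' q a
  have := kap_ne_zero hq r
  have := kap_ne_zero hq a
  have := kap'_ne_zero hq r
  have := kap'_ne_zero hq a
  field_simp
  rw [h2, ← h3, mul_comm]

theorem adj_mul_self {q : K} (hq : q ≠ 0) {t : ℕ} {x : Fin (t + 1) → Fin (t + 1) → A}
    (hx : IsQMat q x) (a b : Fin (t + 1)) :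
    ∑ r, adj q x a r * x r b = if a = b then qMinor K q (t + 1) x else 0 := by
  rw [adj_mul q x a (fun r => x r b)]
  have h := anti_full (pair_anti hq hx (om_anti q)) (List.ofFn a.succAbove ++ [b]) (by simp)
  simp only [List.map_append, List.map_ofFn, List.map_cons, List.map_nil, Function.comp_def] at h
  rw [h]
  split_ifs with hab
  · subst hab
    rw [smul_smul]
    have e : om q (List.ofFn a.succAbove ++ [a]) = kap q a := by
      rw [om_append]
      have := om_mono q (id : Fin t → Fin t) (Fin.strictMono_succAbove a)
      simp only [id] at this
      rw [this]
      have h1 := om_perm q (1 : Equiv.Perm (Fin t))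
      have h2 : invCount (1 : Equiv.Perm (Fin t)) = 0 := by
        unfold invCount
        rw [Finset.card_eq_zero, Finset.filter_eq_empty_iff]
        rintro p _ ⟨h1, h2⟩
        exact absurd h1 h2.not_gt
      rw [h2, pow_zero] at h1
      have h3 : List.ofFn (id : Fin t → Fin t) = List.ofFn (1 : Equiv.Perm (Fin t)) := rfl
      rw [h3, h1]
      simp [om, kap, Function.comp_def, List.prod_ofFn]
    rw [e, inv_mul_cancel₀ (kap_ne_zero hq a), one_smul, qMinor_eq_pair, ← List.ofFn_id, List.map_ofFn]
    rfl
  · rw [om_of_dup, zero_smul, smul_zero]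
    rw [List.nodup_append]
    rintro ⟨_, _, h3⟩
    obtain ⟨k, hk⟩ := Fin.exists_succAbove_eq (Ne.symm hab)
    exact h3 b (List.mem_ofFn.2 ⟨k, hk⟩) b (by simp) rfl

theorem self_mul_adj {q : K} (hq : q ≠ 0) {t : ℕ} {x : Fin (t + 1) → Fin (t + 1) → A}
    (hx : IsQMat q x) (s r : Fin (t + 1)) :
    ∑ a, x s a * adj q x a r = if s = r then qMinor K q (t + 1) x else 0 := by
  rw [mul_adj hq hx r (fun a => x s a)]
  have h := anti_full (pair_anti hq hx.transpose (om_anti q)) (s :: List.ofFn r.succAbove) (by simp)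
  simp only [List.map_ofFn, List.map_cons, List.map_nil, Function.comp_def] at h
  rw [h]
  split_ifs with hab
  · subst hab
    rw [smul_smul]
    have e : om q (s :: List.ofFn s.succAbove) = kap' q s := by
      rw [om]
      have := om_mono q (id : Fin t → Fin t) (Fin.strictMono_succAbove s)
      simp only [id] at this
      rw [this]
      have h1 := om_perm q (1 : Equiv.Perm (Fin t))
      have h2 : invCount (1 : Equiv.Perm (Fin t)) = 0 := by
        unfold invCount
        rw [Finset.card_eq_zero, Finset.filter_eq_empty_iff]
        rintro p _ ⟨h1, h2⟩
        exact absurd h1 h2.not_gt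
      rw [h2, pow_zero] at h1
      have h3 : List.ofFn (id : Fin t → Fin t) = List.ofFn (1 : Equiv.Perm (Fin t)) := rfl
      rw [h3, h1]
      simp [kap', Function.comp_def, List.prod_ofFn]
    rw [e, inv_mul_cancel₀ (kap'_ne_zero hq s), one_smul, ← qMinor_transpose hx, qMinor_eq_pair,
      ← List.ofFn_id, List.map_ofFn]
    rfl
  · rw [om_of_dup, zero_smul, smul_zero]
    rw [List.nodup_cons]
    rintro ⟨h3, _⟩
    obtain ⟨k, hk⟩ := Fin.exists_succAbove_eq hab
    exact h3 (List.mem_ofFn.2 ⟨k, hk⟩)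

end Minor
end QGP

namespace QGP
set_option linter.unusedVariables false
open QG

section Blk
variable {K : Type*} [Field K] {A : Type*} [Ring A] [Algebra K A] {t c : ℕ}

/-- The reversed quantum matrix relations, in Hecke form. -/
structure IsRev {m : ℕ} (q : K) (u : Fin m → Fin c → A) : Prop where
  lt : ∀ j l, j < l → S' q (fun a b => u b j * u a l) = fun a b => u b l * u a j
  eq : ∀ j, (fun a b => u b j * u a j) = fun a b => q • S' q (fun a b => u b j * u a j) a b

theorem IsRev.isQMat {m : ℕ} {q : K} (hq : q ≠ 0) {u : Fin m → Fin c → A} (h : IsRev q u) :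
    IsQMat q (fun i j => u i.rev j) where
  row i j l hj := by
    have := congrFun (congrFun (h.lt j l hj) i.rev) i.rev
    simp only [S', if_true] at this
    rw [← this, smul_smul, mul_inv_cancel₀ hq, one_smul]
  col i k j hi := by
    have := congrFun (congrFun (h.eq j) k.rev) i.rev
    have hi' : k.rev < i.rev := Fin.rev_lt_rev.2 hi
    simpa [S', hi', hi.ne', hi'.ne] using this
  comm i k j l hk hj := by
    have := congrFun (congrFun (h.lt j l hj) i.rev) k.rev
    have hi' : i.rev < k.rev := Fin.rev_lt_rev.2 hk
    simpa [S', hi', hk.ne', hi'.ne] using this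
  qrel i k j l hi hj := by
    have := congrFun (congrFun (h.lt j l hj) i.rev) k.rev
    have hi' : k.rev < i.rev := Fin.rev_lt_rev.2 hi
    simp only [S', hi'.not_gt, hi'.ne', if_false] at this
    have h2 := congrFun (congrFun (h.lt j l hj) k.rev) i.rev
    simp only [S', hi', hi'.ne, if_true, if_false] at h2
    rw [← this, h2]
    abel

theorem IsQMat.isRev {m : ℕ} {q : K} (hq : q ≠ 0) {u : Fin m → Fin c → A}
    (h : IsQMat q (fun i j => u i j)) : IsRev q (fun i j => u i.rev j) where
  lt j l hj := by
    funext a b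
    rcases lt_trichotomy a b with hi | hi | hi
    · have := h.comm a.rev b.rev j l (Fin.rev_lt_rev.2 hi) hj
      simpa [S', hi, hi.ne] using this
    · subst hi
      simp [S', h.row a.rev j l hj, smul_smul, hq]
    · have := h.qrel a.rev b.rev j l (Fin.rev_lt_rev.2 hi) hj
      have h2 := h.comm b.rev a.rev j l (Fin.rev_lt_rev.2 hi) hj
      simp only [S', hi.not_gt, hi.ne', if_false]
      rw [h2, ← this]
      abel
  eq j := by
    funext a b
    rcases lt_trichotomy a b with hi | hi | hi
    · have := h.col b.rev a.rev j (Fin.rev_lt_rev.2 hi)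
      simpa [S', hi, hi.ne] using this
    · subst hi
      simp [S', smul_smul, hq]
    · have := h.col a.rev b.rev j (Fin.rev_lt_rev.2 hi)
      simp only [S', hi.not_gt, hi.ne', if_false]
      rw [this]
      match_scalars
      field_simp
      ring

/-- A square block followed by further columns. -/
structure Blk {m : ℕ} (q : K) (z : Fin m → Fin m → A) (w : Fin m → Fin c → A) : Prop where
  hz : IsQMat q z
  hw : IsQMat q w
  zw : ∀ r s a j, z r a * w s j = S q (fun r s => w r j * z s a) r s

theorem IsQMat.blk {m n : ℕ} {q : K} {x : Fin m → Fin n → A} (hx : IsQMat q x)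
    {f : Fin m → Fin n} {g : Fin c → Fin n} (hf : StrictMono f) (hg : StrictMono g)
    (hfg : ∀ a j, f a < g j) : Blk q (fun r a => x r (f a)) (fun r j => x r (g j)) where
  hz := hx.sub (f := id) strictMono_id hf
  hw := hx.sub (f := id) strictMono_id hg
  zw r s a j := hx.colS r s _ _ (hfg a j)

variable {q : K} 

theorem Blk.pair_gt {m : ℕ} {z : Fin m → Fin m → A} {w : Fin m → Fin c → A} (h : Blk q z w)
    (φ : List (Fin m) → K) (i : Fin m) (l : Fin c) (ρ : List (Fin m)) (hρ : ∀ k ∈ ρ, i < k) :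
    pair φ (ρ.map fun k a => z k a) * w i l = w i l * pair φ (ρ.map fun k a => z k a) := by
  induction ρ generalizing φ with
  | nil => simp [pair]
  | cons k ρ ih =>
    simp only [List.map_cons, pair, Finset.sum_mul, Finset.mul_sum]
    refine Finset.sum_congr rfl fun a _ => ?_
    have hk := hρ k List.mem_cons_self
    rw [mul_assoc, ih _ (fun k hk => hρ k (List.mem_cons_of_mem _ hk)), ← mul_assoc, ← mul_assoc,
      h.zw k i a l]
    simp [S, hk.ne', hk.not_gt]

theorem Blk.pair_mem {m : ℕ} {z : Fin m → Fin m → A} {w : Fin m → Fin c → A} (hq : q ≠ 0)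
    (h : Blk q z w)
    (φ : List (Fin m) → K) (hφ : Anti q φ) (i : Fin m) (l : Fin c) (ρ : List (Fin m))
    (hs : ρ.Pairwise (· < ·)) (hi : i ∈ ρ) :
    pair φ (ρ.map fun k a => z k a) * w i l = q • (w i l * pair φ (ρ.map fun k a => z k a)) := by
  induction ρ generalizing φ with
  | nil => simp at hi
  | cons k ρ ih =>
    rw [List.pairwise_cons] at hs
    rw [List.mem_cons] at hi
    by_cases hik : i = k
    · subst hik
      simp only [List.map_cons, pair, Finset.sum_mul, Finset.mul_sum, Finset.smul_sum]
      refine Finset.sum_congr rfl fun a _ => ?_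
      rw [mul_assoc, h.pair_gt _ i l ρ hs.1, ← mul_assoc, h.zw i i a l]
      simp [S, mul_assoc]
    · have hiρ := hi.resolve_left hik
      have hki := hs.1 i hiρ
      have hz0 : pair φ ((i :: ρ).map fun k a => z k a) = 0 :=
        anti_zero (pair_anti hq h.hz.transpose hφ) (i :: ρ) (by simp [hiρ])
      simp only [List.map_cons, pair] at hz0
      have e : ∀ a, z k a * pair (fun s => φ (a :: s)) (ρ.map fun k a => z k a) * w i l =
          q • (w i l * (z k a * pair (fun s => φ (a :: s)) (ρ.map fun k a => z k a))) +
          (q * (q - q⁻¹)) • (w k l * (z i a * pair (fun s => φ (a :: s)) (ρ.map fun k a => z k a))) := by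
        intro a
        rw [mul_assoc, ih _ (hφ.cons a) hs.2 hiρ, mul_smul_comm, ← mul_assoc, h.zw k i a l]
        simp only [S, hki.ne, hki, if_true, if_false, add_mul, smul_add, smul_mul_assoc, mul_assoc,
          smul_smul]
      simp only [List.map_cons, pair, Finset.sum_mul]
      rw [Finset.sum_congr rfl fun a _ => e a, Finset.sum_add_distrib, ← Finset.smul_sum,
        ← Finset.smul_sum, ← Finset.mul_sum, ← Finset.mul_sum, hz0, mul_zero, smul_zero, add_zero]

theorem Blk.det_mul {m : ℕ} {z : Fin m → Fin m → A} {w : Fin m → Fin c → A} (hq : q ≠ 0)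
    (h : Blk q z w) (i : Fin m) (l : Fin c) :
    qMinor K q m z * w i l = q • (w i l * qMinor K q m z) := by
  have e : qMinor K q m z = pair (om q) ((List.finRange m).map fun k a => z k a) := by
    rw [← qMinor_transpose h.hz, qMinor_eq_pair, ← List.ofFn_id, List.map_ofFn]
    rfl
  rw [e]
  exact h.pair_mem hq _ (om_anti q) i l _ (List.pairwise_lt_finRange m) (List.mem_finRange i)

variable {z : Fin (t + 1) → Fin (t + 1) → A} {w : Fin (t + 1) → Fin c → A}

theorem det_comm (hq : q ≠ 0) (hz : IsQMat q z) (s a : Fin (t + 1)) :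
    qMinor K q (t + 1) z * z s a = z s a * qMinor K q (t + 1) z := by
  have h1 : ∑ b, (∑ r, z s r * adj q z r b) * z b a = qMinor K q (t + 1) z * z s a := by
    simp [self_mul_adj hq hz]
  have h2 : ∑ r, z s r * (∑ b, adj q z r b * z b a) = z s a * qMinor K q (t + 1) z := by
    simp [adj_mul_self hq hz]
  rw [← h1, ← h2]
  simp only [Finset.sum_mul, Finset.mul_sum, mul_assoc]
  exact Finset.sum_comm

theorem det_adj_comm (hq : q ≠ 0) (hz : IsQMat q z) (s a : Fin (t + 1)) :
    qMinor K q (t + 1) z * adj q z s a = adj q z s a * qMinor K q (t + 1) z := by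
  have h1 : ∑ b, (∑ r, adj q z s r * z r b) * adj q z b a = qMinor K q (t + 1) z * adj q z s a := by
    simp [adj_mul_self hq hz]
  have h2 : ∑ r, adj q z s r * (∑ b, z r b * adj q z b a) = adj q z s a * qMinor K q (t + 1) z := by
    simp [self_mul_adj hq hz]
  rw [← h1, ← h2]
  simp only [Finset.sum_mul, Finset.mul_sum, mul_assoc]
  exact Finset.sum_comm

/-- The elements `N_{aj}`. -/
noncomputable def NN (q : K) (z : Fin (t + 1) → Fin (t + 1) → A) (w : Fin (t + 1) → Fin c → A)
    (a : Fin (t + 1)) (j : Fin c) : A := ∑ r, adj q z a r * w r j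

theorem z_NN (hq : q ≠ 0) (hz : IsQMat q z) (s : Fin (t + 1)) (j : Fin c) :
    ∑ a, z s a * NN q z w a j = qMinor K q (t + 1) z * w s j := by
  have h1 : ∑ b, (∑ r, z s r * adj q z r b) * w b j = qMinor K q (t + 1) z * w s j := by
    simp [self_mul_adj hq hz]
  rw [← h1]
  simp only [NN, Finset.sum_mul, Finset.mul_sum, mul_assoc]
  exact Finset.sum_comm

theorem Blk.det_NN (hq : q ≠ 0) (h : Blk q z w) (a : Fin (t + 1)) (j : Fin c) :
    qMinor K q (t + 1) z * NN q z w a j = q • (NN q z w a j * qMinor K q (t + 1) z) := by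
  simp only [NN, Finset.sum_mul, Finset.mul_sum, Finset.smul_sum]
  refine Finset.sum_congr rfl fun r _ => ?_
  rw [← mul_assoc, det_adj_comm hq h.hz, mul_assoc, h.det_mul hq, mul_smul_comm, mul_assoc]

theorem cancel_z (hq : q ≠ 0) (hz : IsQMat q z) (R : Fin (t + 1) → A)
    (h : ∀ r, ∑ d, z r d * R d = 0) (d : Fin (t + 1)) : qMinor K q (t + 1) z * R d = 0 := by
  have h1 : ∑ b, (∑ r, adj q z d r * z r b) * R b = qMinor K q (t + 1) z * R d := by
    simp [adj_mul_self hq hz]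
  rw [← h1]
  have h2 : ∑ r, adj q z d r * (∑ b, z r b * R b) = 0 := by simp [h]
  rw [← h2]
  simp only [Finset.sum_mul, Finset.mul_sum, mul_assoc]
  exact Finset.sum_comm

/-- The mixed commutation relation, up to a factor `D`. -/
theorem Blk.cross (hq : q ≠ 0) (h : Blk q z w) (d s a : Fin (t + 1)) (j : Fin c) :
    qMinor K q (t + 1) z * (NN q z w d j * z s a) = qMinor K q (t + 1) z *
      ∑ e, z s e * S' q (fun d e => if d = a then NN q z w e j else 0) d e := by
  rw [← sub_eq_zero, ← mul_sub]
  refine cancel_z hq h.hz (fun d => NN q z w d j * z s a -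
      ∑ e, z s e * S' q (fun d e => if d = a then NN q z w e j else 0) d e) (fun r => ?_) d
  simp only [mul_sub, Finset.sum_sub_distrib]
  rw [sub_eq_zero]
  simp only [← mul_assoc]
  rw [← Finset.sum_mul, z_NN hq h.hz]
  have e1 : ∑ d, z r d * ∑ e, z s e * S' q (fun d e => if d = a then NN q z w e j else 0) d e =
    ∑ d, ∑ e, z r d * z s e * S' q (fun d e => if d = a then NN q z w e j else 0) d e := by
    simp only [Finset.mul_sum, mul_assoc]
  rw [e1, h.hz.contract' hq]
  have e2 : ∀ r s, ∑ d, ∑ e, z r d * z s e * (if d = a then NN q z w e j else 0) =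
      qMinor K q (t + 1) z * S q (fun r s => w r j * z s a) r s := by
    intro r s
    rw [← h.zw r s a j, ← mul_assoc, det_comm hq h.hz, mul_assoc, ← z_NN hq h.hz, Finset.mul_sum]
    rw [Finset.sum_eq_single a]
    · simp [mul_assoc]
    · intro d _ hd; simp [hd]
    · simp
  simp only [e2]
  rw [← mul_S' q (qMinor K q (t + 1) z) (S q (fun r s => w r j * z s a)), S'_S hq, mul_assoc]

theorem cancel_zz (hq : q ≠ 0) (hz : IsQMat q z) (R : Fin (t + 1) → Fin (t + 1) → A)
    (h : ∀ r s, qMinor K q (t + 1) z * ∑ d, ∑ e, z r d * z s e * R d e = 0) (d e : Fin (t + 1)) :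
    qMinor K q (t + 1) z * (qMinor K q (t + 1) z * (qMinor K q (t + 1) z * R d e)) = 0 := by
  set D := qMinor K q (t + 1) z with hD
  refine cancel_z hq hz (fun e => D * (D * R d e)) (fun s => ?_) e
  have h1 : ∑ e, z s e * (D * (D * R d e)) = D * (∑ e, D * (z s e * R d e)) := by
    rw [Finset.mul_sum]
    refine Finset.sum_congr rfl fun e _ => ?_
    simp only [← mul_assoc]
    rw [← det_comm hq hz, ← hD, mul_assoc D (z s e) D, ← det_comm hq hz, ← hD]
    simp only [← mul_assoc]
  rw [h1]
  refine cancel_z hq hz (fun d => ∑ e, D * (z s e * R d e)) (fun r => ?_) d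
  rw [← h r s, Finset.mul_sum]
  refine Finset.sum_congr rfl fun d _ => ?_
  rw [Finset.mul_sum, Finset.mul_sum]
  refine Finset.sum_congr rfl fun e _ => ?_
  rw [← mul_assoc, ← det_comm hq hz, ← hD]
  simp only [mul_assoc]

theorem Blk.quad (hq : q ≠ 0) (h : Blk q z w) (r s : Fin (t + 1)) (j l : Fin c) :
    qMinor K q (t + 1) z * (qMinor K q (t + 1) z * (qMinor K q (t + 1) z * (w r j * w s l))) =
    q • (qMinor K q (t + 1) z * S' q (fun r s => ∑ d, ∑ e, z r d * z s e *
      (NN q z w e j * NN q z w d l)) r s) := by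
  set D := qMinor K q (t + 1) z with hD
  have e1 : D * (D * (D * (w r j * w s l))) = q • (D * ((D * w r j) * (D * w s l))) := by
    have := h.det_mul hq r j
    rw [← hD] at this
    have e : D * (w r j * w s l) = q • (w r j * (D * w s l)) := by
      rw [← mul_assoc, this, smul_mul_assoc, mul_assoc]
    rw [e, mul_smul_comm, mul_smul_comm, mul_assoc]
  rw [e1]
  congr 1
  have e2 : D * ((D * w r j) * (D * w s l)) =
      ∑ d, ∑ a, z r d * (D * (NN q z w d j * z s a)) * NN q z w a l := by
    rw [hD, ← z_NN hq h.hz (w := w), ← z_NN hq h.hz (w := w), Finset.sum_mul, Finset.mul_sum]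
    refine Finset.sum_congr rfl fun d _ => ?_
    rw [Finset.mul_sum, Finset.mul_sum]
    refine Finset.sum_congr rfl fun a _ => ?_
    simp only [← mul_assoc]
    rw [det_comm hq h.hz]
  rw [e2, ← h.hz.contract' hq, Finset.mul_sum]
  refine Finset.sum_congr rfl fun d _ => ?_
  have e3 : ∀ a, z r d * (D * (NN q z w d j * z s a)) * NN q z w a l =
     ∑ e, D * (z r d * z s e * (S' q (fun d e => if d = a then NN q z w e j else 0) d e * NN q z w a l)) := by
    intro a
    rw [hD, h.cross hq, ← mul_assoc, ← det_comm hq h.hz, Finset.mul_sum, Finset.sum_mul]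
    simp only [mul_assoc]
  rw [Finset.sum_congr rfl fun a _ => e3 a, Finset.sum_comm, Finset.mul_sum]
  refine Finset.sum_congr rfl fun e _ => ?_
  rw [← Finset.mul_sum, ← Finset.mul_sum]
  congr 2
  simp only [S'_mul]
  rw [sum_S']
  congr 1
  funext d e
  simp [ite_mul]

theorem Blk.rel_lt (hq : q ≠ 0) (h : Blk q z w) (d e : Fin (t + 1)) (j l : Fin c) (hj : j < l) :
    qMinor K q (t + 1) z * (qMinor K q (t + 1) z * (qMinor K q (t + 1) z *
      (S' q (fun a b => NN q z w b j * NN q z w a l) d e - NN q z w e l * NN q z w d j))) = 0 := by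
  refine cancel_zz hq h.hz (fun d e => S' q (fun a b => NN q z w b j * NN q z w a l) d e -
    NN q z w e l * NN q z w d j) (fun r s => ?_) d e
  set D := qMinor K q (t + 1) z with hD
  have e1 : ∀ r s, D * S' q (fun r s => ∑ d, ∑ e, z r d * z s e * (NN q z w e j * NN q z w d l)) r s
      = q⁻¹ • (D * (D * (D * (w r j * w s l)))) := fun r s => by
    rw [h.quad hq, smul_smul, inv_mul_cancel₀ hq, one_smul]
  have e2 : (fun r s => D * S' q (fun r s => ∑ d, ∑ e, z r d * z s e * (NN q z w e l * NN q z w d j)) r s)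
      = fun r s => q⁻¹ • (D * (D * (D * (w r l * w s j)))) := by
    funext r s
    rw [h.quad hq, smul_smul, inv_mul_cancel₀ hq, one_smul]
  simp only [mul_sub, Finset.sum_sub_distrib]
  rw [h.hz.contract' hq, e1, h.hw.colS r s j l hj, mul_S, mul_S, mul_S, ← S_smul, ← e2, ← mul_S,
    S_S' hq, sub_self]

theorem Blk.rel_eq (hq : q ≠ 0) (h : Blk q z w) (d e : Fin (t + 1)) (j : Fin c) :
    qMinor K q (t + 1) z * (qMinor K q (t + 1) z * (qMinor K q (t + 1) z *
      (NN q z w e j * NN q z w d j - q • S' q (fun a b => NN q z w b j * NN q z w a j) d e))) = 0 := by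
  refine cancel_zz hq h.hz (fun d e => NN q z w e j * NN q z w d j -
    q • S' q (fun a b => NN q z w b j * NN q z w a j) d e) (fun r s => ?_) d e
  set D := qMinor K q (t + 1) z with hD
  have e2 : (fun r s => D * S' q (fun r s => ∑ d, ∑ e, z r d * z s e * (NN q z w e j * NN q z w d j)) r s)
      = fun r s => q⁻¹ • (D * (D * (D * (w r j * w s j)))) := by
    funext r s
    rw [h.quad hq, smul_smul, inv_mul_cancel₀ hq, one_smul]
  simp only [mul_sub, Finset.sum_sub_distrib, mul_smul_comm, ← Finset.smul_sum]
  rw [h.hz.contract' hq, sub_eq_zero]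
  have e3 := congrFun (congrFun (congrArg (S q) e2) r) s
  rw [← mul_S, S_S' hq] at e3
  rw [e3, S_smul, ← mul_S, ← mul_S, ← mul_S, h.hw.colSS hq]
  have e4 := congrFun (congrFun e2 r) s
  rw [e4]
  simp only [mul_smul_comm]
  rw [smul_comm]

end Blk
end QGP

namespace QGP
set_option linter.unusedVariables false
open QG

section Gen
variable {K : Type*} [Field K] {A : Type*} [Ring A] [Algebra K A] {a b : ℕ} {q : K}

theorem X_isQMat : IsQMat q (fun (i : Fin a) (j : Fin b) => X K q i j) where
  row i j l hj := by
    simp only [X]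
    rw [← map_mul, ← map_mul, ← map_smul]
    exact RingQuot.mkAlgHom_rel K (QMatRel.row i j l hj)
  col i k j hj := by
    simp only [X]
    rw [← map_mul, ← map_mul, ← map_smul]
    exact RingQuot.mkAlgHom_rel K (QMatRel.col i k j hj)
  comm i k j l hk hj := by
    simp only [X]
    rw [← map_mul, ← map_mul]
    exact RingQuot.mkAlgHom_rel K (QMatRel.comm i k j l hk hj)
  qrel i k j l hk hj := by
    simp only [X]
    rw [← map_mul, ← map_mul, ← map_mul, ← map_smul, ← map_sub]
    exact RingQuot.mkAlgHom_rel K (QMatRel.qrel i k j l hk hj)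

/-- The universal property of `QMat`. -/
noncomputable def IsQMat.lift {x : Fin a → Fin b → A} (hx : IsQMat q x) : QMat K q a b →ₐ[K] A :=
  RingQuot.liftAlgHom K ⟨FreeAlgebra.lift K (fun p : Fin a × Fin b => x p.1 p.2), by
    intro u v h
    induction h with
    | row i j l hj => simp [hx.row i j l hj]
    | col i k j hj => simp [hx.col i k j hj]
    | comm i k j l hk hj => simp [hx.comm i k j l hk hj]
    | qrel i k j l hk hj => simp [hx.qrel i k j l hk hj]⟩

@[simp] theorem IsQMat.lift_X {x : Fin a → Fin b → A} (hx : IsQMat q x) (i : Fin a) (j : Fin b) :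
    hx.lift (X K q i j) = x i j := by
  unfold IsQMat.lift X
  rw [RingQuot.liftAlgHom_mkAlgHom_apply, FreeAlgebra.lift_ι_apply]

theorem QMat_adjoin : Algebra.adjoin K (Set.range fun p : Fin a × Fin b => X K q p.1 p.2) = ⊤ := by
  have h1 := FreeAlgebra.adjoin_range_ι K (X := Fin a × Fin b)
  have h2 := congrArg (Subalgebra.map (RingQuot.mkAlgHom K (QMatRel K q a b))) h1
  rw [AlgHom.map_adjoin, ← Set.range_comp, Algebra.map_top,
    (AlgHom.range_eq_top _).2 (RingQuot.mkAlgHom_surjective K _)] at h2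
  exact h2

theorem QMat_hom_ext {f g : QMat K q a b →ₐ[K] A} (h : ∀ i j, f (X K q i j) = g (X K q i j)) :
    f = g := by
  refine AlgHom.ext_of_adjoin_eq_top QMat_adjoin ?_
  rintro _ ⟨p, rfl⟩
  exact h p.1 p.2

/-- Induction for `QMat`. -/
theorem QMat_induction {P : QMat K q a b → Prop} (h1 : P 1)
    (hadd : ∀ f g, P f → P g → P (f + g)) (hs : ∀ (c : K) f, P f → P (c • f))
    (hX : ∀ f i j, P f → P (f * X K q i j)) (f : QMat K q a b) : P f := by
  let V : Submodule K (QMat K q a b) :=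
    { carrier := {f | P f}
      add_mem' := fun h h' => hadd _ _ h h'
      zero_mem' := by have := hs 0 1 h1; rw [zero_smul] at this; exact this
      smul_mem' := fun c f h => hs c f h }
  have key : ∀ g ∈ Algebra.adjoin K (Set.range fun p : Fin a × Fin b => X K q p.1 p.2),
      ∀ f ∈ V, f * g ∈ V := by
    intro g hg
    induction hg using Algebra.adjoin_induction with
    | mem g hg => obtain ⟨p, rfl⟩ := hg; exact fun f hf => hX f p.1 p.2 hf
    | algebraMap r =>
      intro f hf
      rw [← Algebra.commutes, ← Algebra.smul_def]
      exact V.smul_mem r hf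
    | add g g' _ _ h h' => intro f hf; rw [mul_add]; exact V.add_mem (h f hf) (h' f hf)
    | mul g g' _ _ h h' => intro f hf; rw [← mul_assoc]; exact h' _ (h f hf)
  have := key f (by rw [QMat_adjoin]; trivial) 1 h1
  rw [one_mul] at this
  exact this

end Gen

section Gr
variable {K : Type*} [Field K] {q : K} {t n : ℕ}

/-- The square block. -/
noncomputable def zz (K : Type*) [Field K] (q : K) {t n : ℕ} (h : t + 1 < n)
    (r a : Fin (t + 1)) : QMat K q (t + 1) n := X K q r (Fin.castLE h.le a)
/-- The remaining columns. -/
noncomputable def ww (K : Type*) [Field K] (q : K) {t n : ℕ} (h : t + 1 < n)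
    (r : Fin (t + 1)) (j : Fin (n - (t + 1))) : QMat K q (t + 1) n :=
  X K q r ⟨t + 1 + j, by omega⟩

theorem blk_X (h : t + 1 < n) : Blk q (zz K q h) (ww K q h) := by
  refine X_isQMat.blk (f := Fin.castLE h.le) (g := fun j => ⟨t + 1 + j, by omega⟩) ?_ ?_ ?_
  · intro a b hab; exact hab
  · intro a b hab
    rw [Fin.lt_def] at hab ⊢
    simpa using hab
  · intro a j
    rw [Fin.lt_def]
    simp; omega

theorem grMinor_of_mono {m : ℕ} {J : Finset (Fin n)} (f : Fin m → Fin n) (hf : StrictMono f)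
    (hJ : J = Finset.univ.image f) : 
    grMinor K q m J = qMinor K q m (fun i k => X K q i (f k)) := by
  have hc : J.card = m := by
    rw [hJ, Finset.card_image_of_injective _ hf.injective]; simp
  have : f = J.orderEmbOfFin hc := Finset.orderEmbOfFin_unique hc (by
    intro x; rw [hJ]; exact Finset.mem_image_of_mem _ (Finset.mem_univ _)) hf
  rw [grMinor, dif_pos hc, this]

theorem grMinor_consec (h : t + 1 < n) (hn : 0 < n) :
    grMinor K q (t + 1) (consecSet hn (t + 1) 0) = qMinor K q (t + 1) (zz K q h) := by
  refine grMinor_of_mono (Fin.castLE h.le) (fun a b hab => hab) ?_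
  ext l
  simp only [consecSet, Finset.mem_image, Finset.mem_range, fmod, Finset.mem_univ, true_and,
    Fin.ext_iff, Fin.val_castLE]
  constructor
  · rintro ⟨k, hk, hl⟩
    refine ⟨⟨k, hk⟩, ?_⟩
    rw [← hl, zero_add, Nat.mod_eq_of_lt (by omega)]
  · rintro ⟨k, hl⟩
    refine ⟨k, k.2, ?_⟩
    rw [zero_add, Nat.mod_eq_of_lt (by omega), hl]

theorem grMinor_Jx (hq : q ≠ 0) (h : t + 1 < n) (hn : 0 < n) (i : Fin (t + 1))
    (j : Fin (n - (t + 1))) :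
    grMinor K q (t + 1) (JxSet hn (t + 1) 0 i j) =
      kap q i.rev • NN q (zz K q h) (ww K q h) i.rev j := by
  let f : Fin (t + 1) → Fin n := Fin.snoc (α := fun _ => Fin n)
    (fun k => Fin.castLE h.le (i.rev.succAbove k)) ⟨t + 1 + j, by omega⟩
  have f1 : ∀ k : Fin t, f k.castSucc = Fin.castLE h.le (i.rev.succAbove k) := fun k => by simp [f]
  have f2 : f (Fin.last t) = ⟨t + 1 + j, by omega⟩ := by simp [f]
  have hf : StrictMono f := by
    intro a b hab
    induction b using Fin.lastCases with
    | last =>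
      induction a using Fin.lastCases with
      | last => exact absurd hab (lt_irrefl _)
      | cast a =>
        rw [f1, f2, Fin.lt_def]
        simp only [Fin.val_castLE]
        omega
    | cast b =>
      induction a using Fin.lastCases with
      | last => exact absurd hab (Fin.le_last _).not_gt
      | cast a =>
        rw [f1, f1, Fin.lt_def]
        simp only [Fin.val_castLE]
        exact Fin.strictMono_succAbove _ (by simpa using hab)
  rw [grMinor_of_mono f hf, NN, adj_mul, smul_smul, mul_inv_cancel₀ (kap_ne_zero hq _), one_smul,
    qMinor_eq_pair, List.ofFn_succ']
  · simp only [f1, f2, List.concat_eq_append]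
    rfl
  · ext l
    simp only [JxSet, consecSet, Finset.mem_insert, Finset.mem_erase, Finset.mem_image,
      Finset.mem_range, fmod, Finset.mem_univ, true_and, ne_eq, Fin.ext_iff]
    have hm1 : (0 + (t + 1) + (j : ℕ)) % n = t + 1 + j := by
      rw [Nat.mod_eq_of_lt (by omega)]; omega
    have hm2 : (0 + (t + 1 - 1 - (i : ℕ))) % n = t - i := by
      rw [Nat.mod_eq_of_lt (by omega)]; omega
    rw [hm1, hm2]
    constructor
    · rintro (hl | ⟨hl, k, hk, hkl⟩)
      · exact ⟨Fin.last t, by rw [f2]; simp [hl]⟩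
      · rw [Nat.mod_eq_of_lt (by omega)] at hkl
        have hne : (⟨k, hk⟩ : Fin (t + 1)) ≠ i.rev := by
          intro e
          rw [Fin.ext_iff, Fin.val_rev] at e
          simp only at e
          omega
        obtain ⟨k', hk'⟩ := Fin.exists_succAbove_eq hne
        refine ⟨k'.castSucc, ?_⟩
        rw [f1, hk']
        simp only [Fin.val_castLE]
        omega
    · rintro ⟨k, hk⟩
      induction k using Fin.lastCases with
      | last => left; rw [f2] at hk; simpa using hk.symm
      | cast k =>
        right
        rw [f1] at hk
        have hne := Fin.succAbove_ne i.rev k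
        simp only [ne_eq, Fin.ext_iff, Fin.val_rev, Fin.val_castLE] at hne hk
        refine ⟨by omega, l, by omega, ?_⟩
        rw [Nat.mod_eq_of_lt (by omega)]; omega

end Gr
end QGP

namespace QGP
set_option linter.unusedVariables false
open QG

section BB
variable {K : Type*} [Field K] {q : K}

theorem inv_comm_of {A : Type*} [Ring A] [Algebra K A] (hq : q ≠ 0) (y : Aˣ) (a : A)
    (h : (y : A) * a = q • (a * y)) : (↑y⁻¹ : A) * a = q⁻¹ • (a * ↑y⁻¹) := by
  have : a * ↑y⁻¹ = q • (↑y⁻¹ * a) := by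
    calc a * ↑y⁻¹ = ↑y⁻¹ * (↑y * a) * ↑y⁻¹ := by simp
      _ = ↑y⁻¹ * (q • (a * ↑y)) * ↑y⁻¹ := by rw [h]
      _ = q • (↑y⁻¹ * a) := by simp [mul_assoc]
  rw [this, smul_smul, inv_mul_cancel₀ hq, one_smul]

theorem IsQMat.mul_inv {A : Type*} [Ring A] [Algebra K A] (hq : q ≠ 0) {a b : ℕ}
    {x : Fin a → Fin b → A} (hx : IsQMat q x) (y : Aˣ)
    (h : ∀ i j, (y : A) * x i j = q • (x i j * y)) : IsQMat q (fun i j => x i j * ↑y⁻¹) := by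
  have key : ∀ i j k l, x i j * ↑y⁻¹ * (x k l * ↑y⁻¹) = q⁻¹ • (x i j * x k l * (↑y⁻¹ * ↑y⁻¹)) := by
    intro i j k l
    calc x i j * ↑y⁻¹ * (x k l * ↑y⁻¹) = x i j * (↑y⁻¹ * x k l) * ↑y⁻¹ := by simp only [mul_assoc]
      _ = _ := by rw [inv_comm_of hq y _ (h k l)]; simp only [mul_smul_comm, smul_mul_assoc, mul_assoc]
  constructor
  · intro i j l hj; rw [key, key, hx.row i j l hj, smul_mul_assoc, smul_comm]
  · intro i j l hj; rw [key, key, hx.col i j l hj, smul_mul_assoc, smul_comm]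
  · intro i k j l hk hj; rw [key, key, hx.comm i k j l hk hj]
  · intro i k j l hk hj
    rw [key, key, key, ← smul_sub, ← sub_mul, hx.qrel i k j l hk hj, smul_mul_assoc, smul_comm]

variable {t n : ℕ}

theorem NN_mem (h : t + 1 < n) (hn : 0 < n) (hq : q ≠ 0) (a : Fin (t + 1)) (j : Fin (n - (t + 1))) :
    NN q (zz K q h) (ww K q h) a j ∈ qGrass K q (t + 1) n := by
  have e := grMinor_Jx hq h hn a.rev j
  rw [Fin.rev_rev] at e
  have : NN q (zz K q h) (ww K q h) a j = (kap q a)⁻¹ • grMinor K q (t + 1) (JxSet hn (t + 1) 0 a.rev j) := by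
    rw [e, smul_smul, inv_mul_cancel₀ (kap_ne_zero hq a), one_smul]
  rw [this]
  exact Subalgebra.smul_mem (qGrass K q (t + 1) n) (grE K q (t + 1) (JxSet hn (t + 1) 0 a.rev j)).2 _

/-- `N_{aj}` inside the quantum grassmannian. -/
noncomputable def nn (h : t + 1 < n) (hn : 0 < n) (hq : q ≠ 0) (a : Fin (t + 1)) (j : Fin (n - (t + 1))) :
    ↥(qGrass K q (t + 1) n) := ⟨_, NN_mem h hn hq a j⟩

theorem grE_Jx (h : t + 1 < n) (hn : 0 < n) (hq : q ≠ 0) (i : Fin (t + 1)) (j : Fin (n - (t + 1))) :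
    grE K q (t + 1) (JxSet hn (t + 1) 0 i j) = kap q i.rev • nn h hn hq i.rev j :=
  Subtype.ext (grMinor_Jx hq h hn i j)

theorem dd_nn (h : t + 1 < n) (hn : 0 < n) (hq : q ≠ 0) (a : Fin (t + 1)) (j : Fin (n - (t + 1))) :
    grE K q (t + 1) (consecSet hn (t + 1) 0) * nn h hn hq a j =
      q • (nn h hn hq a j * grE K q (t + 1) (consecSet hn (t + 1) 0)) := by
  apply Subtype.ext
  have := (blk_X (K := K) (q := q) h).det_NN hq a j
  rw [← grMinor_consec h hn] at this
  exact this

variable {B : Type*} [Ring B] [Algebra K B]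

theorem dd_cancel (h : t + 1 < n) (hn : 0 < n)
    (L : NormalLoc K (↥(qGrass K q (t + 1) n)) B (grE K q (t + 1) (consecSet hn (t + 1) 0)))
    (r : ↥(qGrass K q (t + 1) n))
    (hr : qMinor K q (t + 1) (zz K q h) * (qMinor K q (t + 1) (zz K q h) *
      (qMinor K q (t + 1) (zz K q h) * (r : QMat K q (t + 1) n))) = 0) : r = 0 := by
  rw [← grMinor_consec h hn] at hr
  set D := grE K q (t + 1) (consecSet hn (t + 1) 0) with hD
  have h1 : D * (D * (D * r)) = 0 := Subtype.ext hr
  have h2 := congrArg L.emb h1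
  rw [map_mul, map_mul, map_mul, map_zero, L.isUnit.mul_right_eq_zero, L.isUnit.mul_right_eq_zero,
    L.isUnit.mul_right_eq_zero] at h2
  exact L.inj (h2.trans (map_zero _).symm)

theorem nn_isRev (h : t + 1 < n) (hn : 0 < n)
    (L : NormalLoc K (↥(qGrass K q (t + 1) n)) B (grE K q (t + 1) (consecSet hn (t + 1) 0)))
    (hq : q ≠ 0) : IsRev q (nn h hn hq) where
  lt j l hj := by
    funext d e
    rw [← sub_eq_zero]
    refine dd_cancel h hn L _ ?_
    have := (blk_X (K := K) (q := q) h).rel_lt hq d e j l hj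
    rw [← this]
    congr 3
    have e1 := map_S' q (qGrass K q (t + 1) n).val.toLinearMap
      (fun a b => nn h hn hq b j * nn h hn hq a l) d e
    simp only [AlgHom.toLinearMap_apply, Subalgebra.coe_val] at e1
    rw [Subalgebra.coe_sub, e1]
    rfl
  eq j := by
    funext d e
    rw [← sub_eq_zero]
    refine dd_cancel h hn L _ ?_
    have := (blk_X (K := K) (q := q) h).rel_eq hq d e j
    rw [← this]
    congr 3
    have e1 := map_S' q (qGrass K q (t + 1) n).val.toLinearMap
      (fun a b => nn h hn hq b j * nn h hn hq a j) d e
    simp only [AlgHom.toLinearMap_apply, Subalgebra.coe_val] at e1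
    rw [Subalgebra.coe_sub, Subalgebra.coe_smul, e1]
    rfl

theorem xElt_eq (h : t + 1 < n) (hn : 0 < n)
    (L : NormalLoc K (↥(qGrass K q (t + 1) n)) B (grE K q (t + 1) (consecSet hn (t + 1) 0)))
    (hq : q ≠ 0) (i : Fin (t + 1)) (j : Fin (n - (t + 1))) :
    xElt K q (t + 1) n hn 0 L i j = kap q i.rev • L.emb (nn h hn hq i.rev j) * ↑(L.isUnit.unit⁻¹) := by
  rw [xElt, grE_Jx h hn hq, map_smul]

theorem y_nn (h : t + 1 < n) (hn : 0 < n)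
    (L : NormalLoc K (↥(qGrass K q (t + 1) n)) B (grE K q (t + 1) (consecSet hn (t + 1) 0)))
    (hq : q ≠ 0) (i : Fin (t + 1)) (j : Fin (n - (t + 1))) :
    (L.isUnit.unit : B) * L.emb (nn h hn hq i j) = q • (L.emb (nn h hn hq i j) * L.isUnit.unit) := by
  have := congrArg L.emb (dd_nn (K := K) (q := q) h hn hq i j)
  rwa [map_mul, map_smul, map_mul] at this

theorem y_sn (h : t + 1 < n) (hn : 0 < n)
    (L : NormalLoc K (↥(qGrass K q (t + 1) n)) B (grE K q (t + 1) (consecSet hn (t + 1) 0)))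
    (hq : q ≠ 0) (i : Fin (t + 1)) (j : Fin (n - (t + 1))) :
    (L.isUnit.unit : B) * (kap q i.rev • L.emb (nn h hn hq i.rev j)) =
      q • ((kap q i.rev • L.emb (nn h hn hq i.rev j)) * L.isUnit.unit) := by
  rw [mul_smul_comm, y_nn, smul_comm, smul_mul_assoc]

theorem xElt_isQMat (h : t + 1 < n) (hn : 0 < n)
    (L : NormalLoc K (↥(qGrass K q (t + 1) n)) B (grE K q (t + 1) (consecSet hn (t + 1) 0)))
    (hq : q ≠ 0) : IsQMat q (fun i j => xElt K q (t + 1) n hn 0 L i j) := by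
  have h1 := ((nn_isRev h hn L hq).isQMat hq).map L.emb
  have h2 := (h1.scale (fun i => kap q i.rev)).mul_inv hq L.isUnit.unit (y_sn h hn L hq)
  convert h2 using 3 with i j
  exact xElt_eq h hn L hq i j

theorem y_x (h : t + 1 < n) (hn : 0 < n)
    (L : NormalLoc K (↥(qGrass K q (t + 1) n)) B (grE K q (t + 1) (consecSet hn (t + 1) 0)))
    (hq : q ≠ 0) (i : Fin (t + 1)) (j : Fin (n - (t + 1))) :
    (L.isUnit.unit : B) * xElt K q (t + 1) n hn 0 L i j =
      q • (xElt K q (t + 1) n hn 0 L i j * L.isUnit.unit) := by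
  rw [xElt_eq h hn L hq, ← mul_assoc, y_sn, smul_mul_assoc]
  simp [mul_assoc]

end BB
end QGP

namespace QGP
set_option linter.unusedVariables false
open QG

section Rep
variable {K : Type*} [Field K] {q : K} {m c : ℕ}

/-- The reversed generators. -/
noncomputable def uu (K : Type*) [Field K] (q : K) {m c : ℕ} (d : Fin m) (j : Fin c) : QMat K q m c :=
  X K q d.rev j

theorem uu_isRev (hq : q ≠ 0) : IsRev q (uu K q (m := m) (c := c)) :=
  IsQMat.isRev hq X_isQMat

/-- The image of the generators under the coaction type map. -/
noncomputable def hh (K : Type*) [Field K] (q : K) {m c : ℕ} (d : Fin m) (j : Fin c) :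
    Matrix (Fin m) (Fin m) (QMat K q m c) :=
  Matrix.of fun e a => S' q (fun d e => if d = a then uu K q e j else 0) d e

/-- Auxiliary three-index function. -/
noncomputable def FF (K : Type*) [Field K] (q : K) {m c : ℕ} (g : Fin m) (j l : Fin c)
    (a b e : Fin m) : QMat K q m c := if a = g then uu K q e j * uu K q b l else 0

theorem hh_mul (j l : Fin c) (a b e g : Fin m) :
    (hh K q b j * hh K q a l) e g = S23' q (S12' q (FF K q g j l)) a b e := by
  rw [Matrix.mul_apply]
  simp only [hh, Matrix.of_apply, S'_mul]
  rw [sum_S']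
  unfold S23' S12'
  congr 1
  funext b e
  have : ∀ f : Fin m, (if b = f then uu K q e j else 0) *
      S' q (fun d e => if d = g then uu K q e l else 0) a f =
      if b = f then uu K q e j * S' q (fun d e => if d = g then uu K q e l else 0) a f else 0 := by
    intro f; split_ifs <;> simp
  simp only [this, Finset.sum_ite_eq, Finset.mem_univ, if_true]
  rw [mul_S']
  congr 1
  funext a b
  simp only [FF, mul_ite, mul_zero]

theorem entry_S' {V : Type*} [AddCommGroup V] [Module K V] (f : Fin m → Fin m → Matrix (Fin m) (Fin m) V)
    (a b e g : Fin m) : S' q f a b e g = S' q (fun a b => f a b e g) a b := by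
  unfold S'; split_ifs <;> simp

theorem hh_isRev (hq : q ≠ 0) : IsRev q (hh K q (m := m) (c := c)) where
  lt j l hj := by
    funext a b
    ext e g
    rw [entry_S', hh_mul]
    simp only [hh_mul]
    change S12' q (S23' q (S12' q (FF K q g j l))) a b e = _
    rw [braid2 hq]
    congr 2
    have : S23' q (FF K q g j l) = FF K q g l j := by
      funext a b e
      have := congrFun (congrFun ((uu_isRev hq).lt j l hj) b) e
      unfold S23' FF
      by_cases h : a = g
      · simpa [h] using this
      · simp [h, S']
    rw [this]
  eq j := by
    funext a b
    ext e g
    rw [Matrix.smul_apply, entry_S', hh_mul]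
    simp only [hh_mul]
    change _ = q • S12' q (S23' q (S12' q (FF K q g j j))) a b e
    rw [braid2 hq]
    have : (FF K q g j j) = fun a b e => q • S23' q (FF K q g j j) a b e := by
      funext a b e
      have := congrFun (congrFun ((uu_isRev hq).eq j) b) e
      unfold S23' FF
      by_cases h : a = g
      · simpa [h] using this
      · simp [h, S']
    conv_lhs => rw [this]
    unfold S23' S12'
    simp only [S'_smul]
    done

/-- The coaction type map. -/
noncomputable def HH (hq : q ≠ 0) : QMat K q m c →ₐ[K] Matrix (Fin m) (Fin m) (QMat K q m c) :=
  IsQMat.lift ((hh_isRev hq).isQMat hq)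

theorem HH_X (hq : q ≠ 0) (i : Fin m) (j : Fin c) : HH hq (X K q i j) = hh K q i.rev j := by
  rw [HH, IsQMat.lift_X]

theorem HH_uu (hq : q ≠ 0) (d : Fin m) (j : Fin c) : HH hq (uu K q d j) = hh K q d j := by
  rw [uu, HH_X, Fin.rev_rev]

theorem delta_S {V : Type*} [AddCommGroup V] [Module K V] (v : V) (d i j l : Fin m) :
    S q (fun d i => if d = j then if i = l then v else 0 else 0) d i =
    S q (fun j l => if d = j then if i = l then v else 0 else 0) j l := by
  unfold S
  rcases lt_trichotomy d i with h | h | h <;> rcases lt_trichotomy j l with h' | h' | h' <;>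
  (by_cases h1 : d = j) <;> (by_cases h2 : i = l) <;> (by_cases h3 : i = j) <;>
  (by_cases h4 : d = l) <;> first
  | (exfalso; omega)
  | (simp [*, ne_of_lt, ne_of_gt, not_lt_of_gt])

end Rep
end QGP

namespace QGP
set_option linter.unusedVariables false
open QG

section Rep
variable {K : Type*} [Field K] {q : K} {m c : ℕ}

/-- Iterated coaction. -/
noncomputable def H2 (hq : q ≠ 0) (f : QMat K q m c) (i k j l : Fin m) : QMat K q m c :=
  HH hq (HH hq f i j) k l

theorem H2_mul (hq : q ≠ 0) (f g : QMat K q m c) (i k j l : Fin m) :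
    H2 hq (f * g) i k j l = ∑ a, ∑ b, H2 hq f i k a b * H2 hq g a b j l := by
  unfold H2
  rw [map_mul, Matrix.mul_apply, map_sum, Matrix.sum_apply]
  refine Finset.sum_congr rfl fun a _ => ?_
  rw [map_mul, Matrix.mul_apply]

/-- Linear functional attached to `S12' S23'`. -/
def TT (K : Type*) [Field K] (q : K) {m : ℕ} {V : Type*} [AddCommGroup V] [Module K V]
    (d i k : Fin m) : (Fin m → Fin m → Fin m → V) →ₗ[K] V where
  toFun F := S12' q (S23' q F) d i k
  map_add' F G := by
    have e : ∀ F G : Fin m → Fin m → V, ∀ i k, S' q (fun i k => F i k + G i k) i k =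
      S' q F i k + S' q G i k := by
      intro F G i k; unfold S'; split_ifs <;> simp only [smul_add]; abel
    unfold S12' S23'
    rw [← e]
    congr 1
    funext i j
    exact e _ _ _ _
  map_smul' r F := by
    unfold S12' S23'
    simp only [RingHom.id_apply, ← S'_smul]
    rfl

theorem H2_X (hq : q ≠ 0) (d : Fin m) (j0 : Fin c) (i k j l : Fin m) :
    H2 hq (uu K q d j0) i k j l = TT K q d i k
      (fun d i k => if d = j then if i = l then uu K q k j0 else 0 else 0) := by
  unfold H2
  have h1 := map_S' q ((Matrix.entryLinearMap K (QMat K q m c) k l).comp (HH hq).toLinearMap)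
    (fun d e => if d = j then uu K q e j0 else 0) d i
  rw [HH_uu]
  simp only [hh, Matrix.of_apply]
  simp only [LinearMap.comp_apply, AlgHom.toLinearMap_apply, Matrix.entryLinearMap_apply] at h1
  rw [h1]
  change _ = S12' q (S23' q _) d i k
  unfold S12' S23'
  congr 1
  funext d i
  by_cases h : d = j
  · simp only [h, if_true]
    rw [HH_uu, hh, Matrix.of_apply]
  · simp only [h, if_false]
    simp [S']

theorem H2_rtt (hq : q ≠ 0) (f : QMat K q m c) (i k j l : Fin m) :
    S q (fun i k => H2 hq f i k j l) i k = S q (fun j l => H2 hq f i k j l) j l := by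
  revert i k j l
  induction f using QMat_induction with
  | h1 =>
    intro i k j l
    have : ∀ i k j l, H2 hq (1 : QMat K q m c) i k j l = if i = j then if k = l then 1 else 0 else 0 := by
      intro i k j l
      unfold H2
      rw [map_one, Matrix.one_apply]
      by_cases h : i = j
      · simp [h, Matrix.one_apply]
      · simp [h]
    simp only [this]
    exact delta_S _ _ _ _ _
  | hadd f g hf hg =>
    intro i k j l
    have : ∀ i k j l, H2 hq (f + g) i k j l = H2 hq f i k j l + H2 hq g i k j l := by
      intros; simp [H2]
    have e : ∀ F G : Fin m → Fin m → QMat K q m c, ∀ i k, S q (fun i k => F i k + G i k) i k =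
      S q F i k + S q G i k := by
      intro F G i k; unfold S; split_ifs <;> simp only [smul_add]; abel
    simp only [this]
    rw [e, e, hf, hg]
  | hs r f hf =>
    intro i k j l
    have : ∀ i k j l, H2 hq (r • f) i k j l = r • H2 hq f i k j l := by
      intros; simp [H2]
    simp only [this]
    rw [S_smul, S_smul, hf]
  | hX f i0 j0 hf =>
    intro i k j l
    have hX : ∀ i k j l, S q (fun i k => H2 hq (X K q i0 j0) i k j l) i k =
        S q (fun j l => H2 hq (X K q i0 j0) i k j l) j l := by
      have e : X K q i0 j0 = uu K q i0.rev j0 := by rw [uu, Fin.rev_rev]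
      rw [e]
      generalize i0.rev = d
      intro i k j l
      simp only [H2_X]
      change S23 q (S12' q (S23' q (fun d i k => if d = j then if i = l then uu K q k j0 else 0 else 0))) d i k = _
      rw [braid1 hq, ← map_S]
      change _ = S12' q (S23' q _) d i k
      congr 2
      funext d i k
      unfold S12
      rw [delta_S]
      unfold S
      split_ifs <;> simp_all
    simp only [H2_mul]
    rw [← sum_S]
    have e1 : ∀ a, S q (fun i k => ∑ b, H2 hq f i k a b * H2 hq (X K q i0 j0) a b j l) i k =
        ∑ b, S q (fun a b => H2 hq f i k a b) a b * H2 hq (X K q i0 j0) a b j l := by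
      intro a
      rw [← sum_S]
      refine Finset.sum_congr rfl fun b _ => ?_
      rw [← S_mul q _ (fun i k => H2 hq f i k a b), hf]
    rw [Finset.sum_congr rfl fun a _ => e1 a, S_symm q (fun a b => H2 hq f i k a b) (fun a b => H2 hq (X K q i0 j0) a b j l), ← sum_S]
    refine Finset.sum_congr rfl fun a _ => ?_
    rw [← sum_S]
    refine Finset.sum_congr rfl fun b _ => ?_
    rw [hX, mul_S]

/-- Right operators. -/
def EE (K : Type*) [Field K] (q : K) (m c : ℕ) := (Module.End K (QMat K q m c))ᵐᵒᵖ
noncomputable instance (K : Type*) [Field K] (q : K) (m c : ℕ) : Ring (EE K q m c) :=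
  inferInstanceAs (Ring (Module.End K (QMat K q m c))ᵐᵒᵖ)
noncomputable instance (K : Type*) [Field K] (q : K) (m c : ℕ) : Algebra K (EE K q m c) :=
  inferInstanceAs (Algebra K (Module.End K (QMat K q m c))ᵐᵒᵖ)

theorem EE_ext {f g : EE K q m c} (h : ∀ v, f.unop v = g.unop v) : f = g :=
  MulOpposite.unop_injective (LinearMap.ext h)

/-- Operator `z`. -/
noncomputable def zE (hq : q ≠ 0) (c : ℕ) (s a : Fin m) : EE K q m c :=
  MulOpposite.op ((Matrix.entryLinearMap K (QMat K q m c) s a).comp (HH hq).toLinearMap)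

theorem zE_apply (hq : q ≠ 0) (s a : Fin m) (v : QMat K q m c) :
    (zE hq c s a).unop v = HH hq v s a := rfl

/-- Right multiplication. -/
noncomputable def rho (K : Type*) [Field K] (q : K) (m c : ℕ) : QMat K q m c →ₐ[K] EE K q m c where
  toFun v := MulOpposite.op (LinearMap.mulRight K v)
  map_one' := EE_ext fun v => mul_one v
  map_mul' a b := EE_ext fun v => (mul_assoc v a b).symm
  map_zero' := EE_ext fun v => mul_zero v
  map_add' a b := EE_ext fun v => mul_add v a b
  commutes' r := EE_ext fun v => by
    change v * algebraMap K _ r = r • v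
    rw [Algebra.smul_def, Algebra.commutes]

theorem rho_apply (a v : QMat K q m c) : (rho K q m c a).unop v = v * a := rfl

theorem EE_mul (f g : EE K q m c) (v) : (f * g).unop v = g.unop (f.unop v) := rfl

/-- Evaluation as a linear map. -/
noncomputable def evE (K : Type*) [Field K] (q : K) (m c : ℕ) (v : QMat K q m c) :
    EE K q m c →ₗ[K] QMat K q m c where
  toFun f := f.unop v
  map_add' _ _ := rfl
  map_smul' _ _ := rfl

theorem zE_isQMat (hq : q ≠ 0) : IsQMat q (zE (K := K) (m := m) hq c) := by
  refine IsQMat.ofRtt hq fun i k j l => EE_ext fun v => ?_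
  have := H2_rtt hq v i k j l
  change evE K q m c v _ = evE K q m c v _
  rw [map_S, map_S]
  exact this

/-- Operator `u`. -/
noncomputable def uE (K : Type*) [Field K] (q : K) {m c : ℕ} (d : Fin m) (j : Fin c) : EE K q m c :=
  rho K q m c (uu K q d j)

theorem uE_isRev (hq : q ≠ 0) : IsRev q (uE K q (m := m) (c := c)) := by
  have h1 : IsQMat q (fun (i : Fin m) (j : Fin c) => X K q i j) := X_isQMat
  exact IsQMat.isRev hq (h1.map (rho K q m c))

theorem crossE (hq : q ≠ 0) (d s a : Fin m) (j : Fin c) :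
    uE K q d j * zE hq c s a =
      ∑ e, zE hq c s e * S' q (fun d e => if d = a then uE K q e j else 0) d e := by
  refine EE_ext fun v => ?_
  rw [EE_mul, zE_apply, uE, rho_apply, map_mul, Matrix.mul_apply]
  change _ = evE K q m c v _
  rw [map_sum]
  refine Finset.sum_congr rfl fun e _ => ?_
  change _ = (S' q (fun d e => if d = a then uE K q e j else 0) d e).unop ((zE hq c s e).unop v)
  rw [zE_apply, HH_uu, hh, Matrix.of_apply]
  have := map_S' q (rho K q m c).toLinearMap (fun d e => if d = a then uu K q e j else 0) d e
  simp only [AlgHom.toLinearMap_apply] at this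
  rw [← rho_apply, this]
  congr 3
  funext d e
  split_ifs <;> simp [uE]

end Rep

section Comb
variable {K : Type*} [Field K] {q : K} {m c : ℕ} {A : Type*} [Ring A] [Algebra K A]

theorem blk_of_cross (hq : q ≠ 0) {z : Fin m → Fin m → A} {u : Fin m → Fin c → A} (hz : IsQMat q z)
    (hu : IsRev q u) (hc : ∀ d s a j, u d j * z s a =
      ∑ e, z s e * S' q (fun d e => if d = a then u e j else 0) d e) :
    Blk q z (fun r j => ∑ d, z r d * u d j) := by
  have key : ∀ r s j l, (∑ d, z r d * u d j) * (∑ d, z s d * u d l) =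
      S' q (fun r s => ∑ d, ∑ e, z r d * z s e * (u e j * u d l)) r s := by
    intro r s j l
    rw [← hz.contract' hq, Finset.sum_mul]
    refine Finset.sum_congr rfl fun d _ => ?_
    rw [Finset.mul_sum]
    have e3 : ∀ a, z r d * u d j * (z s a * u a l) =
       ∑ e, z r d * z s e * (S' q (fun d e => if d = a then u e j else 0) d e * u a l) := by
      intro a
      rw [← mul_assoc, mul_assoc (z r d), hc, Finset.mul_sum, Finset.sum_mul]
      simp only [mul_assoc]
    rw [Finset.sum_congr rfl fun a _ => e3 a, Finset.sum_comm]
    refine Finset.sum_congr rfl fun e _ => ?_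
    rw [← Finset.mul_sum]
    congr 1
    simp only [S'_mul]
    rw [sum_S']
    congr 1
    funext d e
    simp [ite_mul]
  refine ⟨hz, IsQMat.ofS hq ?_ ?_, ?_⟩
  · intro r s j l hj
    simp only [key]
    rw [S_S' hq, ← hz.contract' hq, hu.lt j l hj]
  · intro r s j
    simp only [key]
    rw [S_S' hq, ← hz.contract' hq]
    simp only [Finset.smul_sum]
    refine Finset.sum_congr rfl fun d _ => Finset.sum_congr rfl fun e _ => ?_
    rw [← mul_smul_comm]
    congr 1
    exact congrFun (congrFun (hu.eq j) d) e
  · intro r s a j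
    have : (fun r s => (∑ d, z r d * u d j) * z s a) =
        S' q (fun r s => z r a * ∑ d, z s d * u d j) := by
      funext r s
      have e2 : ∀ r s, z r a * ∑ d, z s d * u d j =
        ∑ d, ∑ e, z r d * z s e * (if d = a then u e j else 0) := by
        intro r s
        rw [Finset.mul_sum, Finset.sum_eq_single (f := fun d => ∑ e, _) a]
        · simp [mul_assoc]
        · intro d _ hd; simp [hd]
        · simp
      simp only [e2]
      rw [← hz.contract' hq, Finset.sum_mul]
      refine Finset.sum_congr rfl fun d _ => ?_
      rw [mul_assoc, hc, Finset.mul_sum]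
      simp only [mul_assoc]
    rw [this, S_S' hq]

theorem Blk.isQMat {n : ℕ} (h : m < n) (hq : q ≠ 0) {z : Fin m → Fin m → A}
    {w : Fin m → Fin (n - m) → A} (hb : Blk q z w) :
    IsQMat q (fun (r : Fin m) (l : Fin n) => if hl : (l : ℕ) < m then z r ⟨l, hl⟩ else
      w r ⟨l - m, by omega⟩) := by
  refine IsQMat.ofS hq ?_ ?_
  · intro r s j l hj
    rw [Fin.lt_def] at hj
    by_cases h1 : (j : ℕ) < m
    · by_cases h2 : (l : ℕ) < m
      · simp only [h1, h2, dif_pos]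
        exact hb.hz.colS r s _ _ hj
      · simp only [h1, h2, dif_pos, dif_neg, not_false_eq_true]
        exact hb.zw r s _ _
    · have h2 : ¬ (l : ℕ) < m := by omega
      simp only [h1, h2, dif_neg, not_false_eq_true]
      exact hb.hw.colS r s _ _ (by rw [Fin.lt_def]; simp only; omega)
  · intro r s j
    by_cases h1 : (j : ℕ) < m
    · simp only [h1, dif_pos]
      exact hb.hz.colSS hq r s _
    · simp only [h1, dif_neg, not_false_eq_true]
      exact hb.hw.colSS hq r s _

end Comb

section Psi
variable {K : Type*} [Field K] {q : K} {t n : ℕ}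

theorem blkE (hq : q ≠ 0) (c : ℕ) : Blk q (zE (K := K) (m := t + 1) hq c)
    (fun r j => ∑ d, zE hq c r d * uE K q d j) :=
  blk_of_cross hq (zE_isQMat hq) (uE_isRev hq) (fun d s a j => crossE hq d s a j)

/-- The representation. -/
noncomputable def Psi (hq : q ≠ 0) (h : t + 1 < n) :
    QMat K q (t + 1) n →ₐ[K] EE K q (t + 1) (n - (t + 1)) :=
  ((blkE hq (n - (t + 1))).isQMat h hq).lift

theorem Psi_zz (hq : q ≠ 0) (h : t + 1 < n) (r a : Fin (t + 1)) :
    Psi hq h (zz K q h r a) = zE hq _ r a := by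
  rw [Psi, zz, IsQMat.lift_X]
  exact dif_pos a.2

theorem Psi_ww (hq : q ≠ 0) (h : t + 1 < n) (r : Fin (t + 1)) (j) :
    Psi hq h (ww K q h r j) = ∑ d, zE hq _ r d * uE K q d j := by
  rw [Psi, ww, IsQMat.lift_X]
  rw [dif_neg (by simp only; omega)]
  simp

theorem map_qMinor {A C : Type*} [Ring A] [Algebra K A] [Ring C] [Algebra K C] (f : A →ₐ[K] C) (m : ℕ)
    (x : Fin m → Fin m → A) : f (qMinor K q m x) = qMinor K q m (fun i j => f (x i j)) := by
  simp [qMinor, map_list_prod, List.map_ofFn, Function.comp_def]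

theorem Psi_D (hq : q ≠ 0) (h : t + 1 < n) :
    Psi hq h (qMinor K q (t + 1) (zz K q h)) = qMinor K q (t + 1) (zE hq _) := by
  rw [map_qMinor]
  simp only [Psi_zz]

theorem Psi_NN (hq : q ≠ 0) (h : t + 1 < n) (a : Fin (t + 1)) (j) :
    Psi hq h (NN q (zz K q h) (ww K q h) a j) =
      Psi hq h (qMinor K q (t + 1) (zz K q h)) * uE K q a j := by
  simp only [Psi_D, NN, adj, map_sum, map_mul, map_smul, map_qMinor, Psi_zz, Psi_ww]
  have h1 : ∑ b, (∑ r, adj q (zE hq _) a r * zE hq _ r b) * uE K q b j =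
      qMinor K q (t + 1) (zE hq (n - (t + 1))) * uE K q a j := by
    simp [adj_mul_self hq (zE_isQMat hq)]
  rw [← h1]
  simp only [adj, Finset.sum_mul, Finset.mul_sum, mul_assoc]
  exact Finset.sum_comm

theorem list_ev (m c : ℕ) (Ls : List (EE K q m c × K)) (hL : ∀ p ∈ Ls, p.1.unop 1 = p.2 • 1) :
    ((Ls.map Prod.fst).prod).unop 1 = (Ls.map Prod.snd).prod • (1 : QMat K q m c) := by
  induction Ls with
  | nil => simp; rfl
  | cons p Ls ih =>
    rw [List.map_cons, List.prod_cons, EE_mul, hL p List.mem_cons_self, map_smul,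
      ih (fun p hp => hL p (List.mem_cons_of_mem _ hp)), smul_smul, List.map_cons, List.prod_cons]

theorem D_one (hq : q ≠ 0) (m c : ℕ) :
    (qMinor K q m (zE hq c)).unop (1 : QMat K q m c) = 1 := by
  have e : ∀ σ : Equiv.Perm (Fin m), (List.ofFn fun k => zE hq c (σ k) k).prod.unop
      (1 : QMat K q m c) = (∏ k, if σ k = k then (1 : K) else 0) • 1 := by
    intro σ
    have := list_ev m c (List.ofFn fun k => (zE hq c (σ k) k, if σ k = k then (1 : K) else 0)) (by
      intro p hp
      obtain ⟨k, rfl⟩ := List.mem_ofFn.1 hp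
      simp only [zE_apply, map_one, Matrix.one_apply]
      split_ifs <;> simp)
    rw [List.map_ofFn, List.map_ofFn, List.prod_ofFn (f := (Prod.snd ∘ _))] at this
    exact this
  change evE K q m c 1 _ = 1
  unfold qMinor
  rw [map_sum, Finset.sum_eq_single 1]
  · rw [map_smul]
    change _ • (List.ofFn fun k => zE hq c ((1 : Equiv.Perm (Fin m)) k) k).prod.unop 1 = _
    rw [e]
    have h2 : invCount (1 : Equiv.Perm (Fin m)) = 0 := by
      unfold invCount
      rw [Finset.card_eq_zero, Finset.filter_eq_empty_iff]
      rintro p _ ⟨h1, h2⟩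
      exact absurd h1 h2.not_gt
    simp [h2]
  · intro σ _ hσ
    rw [map_smul]
    change _ • (List.ofFn fun k => zE hq c (σ k) k).prod.unop 1 = _
    rw [e]
    obtain ⟨k, hk⟩ : ∃ k, σ k ≠ k := by
      by_contra hc
      push Not at hc
      exact hσ (Equiv.ext hc)
    rw [Finset.prod_eq_zero (Finset.mem_univ k) (by simp [hk]), zero_smul, smul_zero]
  · simp

end Psi
end QGP

namespace QGP
set_option linter.unusedVariables false
open QG

section Inj
variable {K : Type*} [Field K] {q : K} {t n : ℕ} {B : Type*} [Ring B] [Algebra K B]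

/-- The scaling automorphism. -/
noncomputable def thN (q : K) (a b : ℕ) (N : ℕ) : QMat K q (a + 1) b →ₐ[K] QMat K q (a + 1) b :=
  (X_isQMat.scale (fun i : Fin (a + 1) => kap q i.rev * (q * q⁻¹ ^ N))).lift

theorem thN_X (a b N : ℕ) (i : Fin (a + 1)) (j : Fin b) :
    thN q a b N (X K q i j) = (kap q i.rev * (q * q⁻¹ ^ N)) • X K q i j := by
  rw [thN, IsQMat.lift_X]

theorem thN_inj (hq : q ≠ 0) (a b N : ℕ) : Function.Injective (thN q a b N) := by
  have hne : ∀ i : Fin (a + 1), kap q i.rev * (q * q⁻¹ ^ N) ≠ 0 := fun i =>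
    mul_ne_zero (kap_ne_zero hq _) (mul_ne_zero hq (pow_ne_zero _ (inv_ne_zero hq)))
  let g : QMat K q (a + 1) b →ₐ[K] QMat K q (a + 1) b :=
    (X_isQMat.scale (fun i : Fin (a + 1) => (kap q i.rev * (q * q⁻¹ ^ N))⁻¹)).lift
  have hg : g.comp (thN q a b N) = AlgHom.id K _ := by
    apply QMat_hom_ext
    intro i j
    rw [AlgHom.comp_apply, thN_X, map_smul]
    simp only [g, IsQMat.lift_X]
    rw [smul_smul, mul_inv_cancel₀ (hne i), one_smul]
    rfl
  exact Function.LeftInverse.injective (g := g) (fun f => DFunLike.congr_fun hg f)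

theorem pow_comm_of {A : Type*} [Ring A] [Algebra K A] (y a : A)
    (h : y * a = q • (a * y)) (N : ℕ) : y ^ N * a = q ^ N • (a * y ^ N) := by
  induction N with
  | zero => simp
  | succ N ih =>
    rw [pow_succ', mul_assoc, ih, mul_smul_comm, ← mul_assoc, h, smul_mul_assoc, smul_smul,
      mul_assoc, ← pow_succ]

theorem phi_key (h : t + 1 < n) (hn : 0 < n)
    (L : NormalLoc K (↥(qGrass K q (t + 1) n)) B (grE K q (t + 1) (consecSet hn (t + 1) 0)))
    (hq : q ≠ 0) (f : QMat K q (t + 1) (n - (t + 1))) :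
    ∃ N0 : ℕ, ∀ N, N0 ≤ N → ∃ a : ↥(qGrass K q (t + 1) n),
      (xElt_isQMat h hn L hq).lift f * (L.isUnit.unit : B) ^ N = L.emb a ∧
      (Psi hq h (a : QMat K q (t + 1) n)).unop 1 = thN q t _ N f := by
  have hdd : ((grE K q (t + 1) (consecSet hn (t + 1) 0) : ↥(qGrass K q (t + 1) n)) :
      QMat K q (t + 1) n) = qMinor K q (t + 1) (zz K q h) := grMinor_consec h hn
  induction f using QMat_induction with
  | h1 =>
    refine ⟨0, fun N _ => ⟨grE K q (t + 1) (consecSet hn (t + 1) 0) ^ N, ?_, ?_⟩⟩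
    · rw [map_one, one_mul, map_pow]; rfl
    · rw [map_one (thN q t _ N), SubmonoidClass.coe_pow, hdd, map_pow, Psi_D]
      induction N with
      | zero => rfl
      | succ N ih => rw [pow_succ, EE_mul, ih (by omega), D_one]
  | hadd f g hf hg =>
    obtain ⟨M1, h1⟩ := hf
    obtain ⟨M2, h2⟩ := hg
    refine ⟨max M1 M2, fun N hN => ?_⟩
    obtain ⟨a, ha, ha'⟩ := h1 N (le_trans (le_max_left _ _) hN)
    obtain ⟨b, hb, hb'⟩ := h2 N (le_trans (le_max_right _ _) hN)
    refine ⟨a + b, ?_, ?_⟩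
    · rw [map_add, add_mul, ha, hb, map_add]
    · rw [map_add, ← ha', ← hb', Subalgebra.coe_add, map_add]; rfl
  | hs c f hf =>
    obtain ⟨M1, h1⟩ := hf
    refine ⟨M1, fun N hN => ?_⟩
    obtain ⟨a, ha, ha'⟩ := h1 N hN
    refine ⟨c • a, ?_, ?_⟩
    · rw [map_smul, smul_mul_assoc, ha, map_smul]
    · rw [map_smul, ← ha', Subalgebra.coe_smul, map_smul]; rfl
  | hX f i j hf =>
    obtain ⟨M1, h1⟩ := hf
    refine ⟨M1 + 1, fun N hN => ?_⟩
    obtain ⟨N, rfl⟩ : ∃ N', N = N' + 1 := ⟨N - 1, by omega⟩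
    obtain ⟨a, ha, ha'⟩ := h1 N (by omega)
    obtain ⟨b, hb, hb'⟩ := h1 (N + 1) (by omega)
    have hba : b = a * grE K q (t + 1) (consecSet hn (t + 1) 0) := by
      apply L.inj
      rw [← hb, pow_succ, ← mul_assoc, ha, map_mul]; rfl
    refine ⟨(kap q i.rev * q⁻¹ ^ N) • (a * nn h hn hq i.rev j), ?_, ?_⟩
    · rw [map_mul, IsQMat.lift_X, xElt_eq h hn L hq, map_smul, map_mul, ← ha, mul_assoc _ (_ ^ N),
        pow_comm_of _ _ (y_nn h hn L hq i.rev j), mul_smul_comm, smul_smul, mul_assoc (kap _ _), mul_assoc, inv_pow,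
        inv_mul_cancel₀ (pow_ne_zero N hq), mul_one, pow_succ']
      simp only [smul_mul_assoc, mul_smul_comm, mul_assoc]
      rw [Units.inv_mul_cancel_left]
    · rw [map_mul, thN_X, ← hb', hba, Subalgebra.coe_smul, Subalgebra.coe_mul, Subalgebra.coe_mul, hdd,
        map_smul, map_mul]
      change (_ • (Psi hq h _ * Psi hq h (NN q (zz K q h) (ww K q h) i.rev j))).unop 1 = _
      rw [Psi_NN, ← mul_assoc, ← map_mul]
      change (kap q i.rev * q⁻¹ ^ N) • ((Psi hq h _ * uE K q i.rev j).unop 1) = _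
      rw [EE_mul, uE, rho_apply, uu, Fin.rev_rev, mul_smul_comm]
      congr 1
      rw [pow_succ', mul_inv_cancel_left₀ hq]

theorem phi_inj (h : t + 1 < n) (hn : 0 < n)
    (L : NormalLoc K (↥(qGrass K q (t + 1) n)) B (grE K q (t + 1) (consecSet hn (t + 1) 0)))
    (hq : q ≠ 0) : Function.Injective (xElt_isQMat h hn L hq).lift := by
  rw [injective_iff_map_eq_zero]
  intro f hf
  obtain ⟨N, hN⟩ := phi_key h hn L hq f
  obtain ⟨a, ha, ha'⟩ := hN N le_rfl
  rw [hf, zero_mul] at ha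
  have : a = 0 := L.inj (ha.symm.trans (map_zero _).symm)
  rw [this, ZeroMemClass.coe_zero, map_zero] at ha'
  exact thN_inj hq _ _ N (ha'.symm.trans (map_zero _).symm)

end Inj
end QGP

namespace QGP
set_option linter.unusedVariables false
open QG

section Tw
variable {K : Type*} [Field K] {q p : K} {n m : ℕ}

theorem cmap_eq (hn : 0 < n) (hp : p ≠ 0) (s t : Fin n → ℤ) :
    cmap K hn p s t = p ^ (s (lastIdx n hn) *
      ∑ j ∈ Finset.univ.filter (fun j : Fin n => j ≠ lastIdx n hn), t j) := by
  unfold cmap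
  generalize Finset.univ.filter (fun j : Fin n => j ≠ lastIdx n hn) = F
  rw [Finset.mul_sum]
  induction F using Finset.induction_on with
  | empty => simp
  | insert a F ha ih => rw [Finset.prod_insert ha, Finset.sum_insert ha, zpow_add₀ hp, ih]

/-- Indicator of the last column. -/
def lst (m n : ℕ) (j : Fin (n - m)) : ℤ := if (j : ℕ) = n - m - 1 then 1 else 0

theorem x_last (hn : 0 < n) (h : m < n) (i : Fin m) (j : Fin (n - m)) :
    xContent m n i j (lastIdx n hn) = lst m n j := by
  have := i.2
  have := j.2
  unfold xContent lastIdx lst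
  simp only
  split_ifs <;> omega

theorem sum_ne_last (hn : 0 < n) (t : Fin n → ℤ) :
    ∑ j ∈ Finset.univ.filter (fun j : Fin n => j ≠ lastIdx n hn), t j =
      ∑ j, t j - t (lastIdx n hn) := by
  rw [Finset.filter_ne', ← Finset.sum_erase_add _ _ (Finset.mem_univ (lastIdx n hn))]
  ring

theorem x_sum (hn : 0 < n) (h : m < n) (i : Fin m) (j : Fin (n - m)) :
    ∑ l ∈ Finset.univ.filter (fun l : Fin n => l ≠ lastIdx n hn), xContent m n i j l =
      - lst m n j := by
  have h1 := i.2
  have h2 := j.2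
  rw [sum_ne_last, x_last hn h]
  have e1 : ∑ l : Fin n, (if (l : ℕ) = m + j then (1 : ℤ) else 0) = 1 := by
    rw [Finset.sum_eq_single ⟨m + j, by omega⟩]
    · simp
    · intro b _ hb
      rw [if_neg]
      intro hc; exact hb (Fin.ext hc)
    · simp
  have e2 : ∑ l : Fin n, (if (l : ℕ) = m - 1 - i then (1 : ℤ) else 0) = 1 := by
    rw [Finset.sum_eq_single ⟨m - 1 - i, by omega⟩]
    · simp
    · intro b _ hb
      rw [if_neg]
      intro hc; exact hb (Fin.ext hc)
    · simp
  unfold xContent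
  rw [Finset.sum_sub_distrib, e1, e2]
  ring

theorem y_last (hn : 0 < n) (h : m < n) : yContent m n (lastIdx n hn) = 0 := by
  unfold yContent lastIdx
  simp only
  rw [if_neg]; omega

theorem y_sum (hn : 0 < n) (h : m < n) :
    ∑ l ∈ Finset.univ.filter (fun l : Fin n => l ≠ lastIdx n hn), yContent m n l = m := by
  rw [sum_ne_last, y_last hn h]
  unfold yContent
  rw [Finset.sum_boole, sub_zero]
  congr 1
  have : (Finset.univ.filter fun l : Fin n => (l : ℕ) < m) =
      (Finset.univ : Finset (Fin m)).map (Fin.castLEEmb h.le) := by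
    ext l
    simp only [Finset.mem_filter, Finset.mem_univ, true_and, Finset.mem_map]
    constructor
    · intro hl; exact ⟨⟨l, hl⟩, rfl⟩
    · rintro ⟨a, rfl⟩; exact a.2
  rw [this]; simp

variable {B : Type*} [Ring B] [Algebra K B] (𝒜 : (Fin n → ℤ) → Submodule K B) [GradedAlgebra 𝒜]

/-- Degreewise scaling. -/
noncomputable def Dg (g : (Fin n → ℤ) → K) : B →ₗ[K] B :=
  (DirectSum.toModule K (Fin n → ℤ) B (fun s => g s • (𝒜 s).subtype)).comp
    (DirectSum.decomposeLinearEquiv 𝒜).toLinearMap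

theorem Dg_apply (g : (Fin n → ℤ) → K) {s : Fin n → ℤ} {b : B} (hb : b ∈ 𝒜 s) :
    Dg 𝒜 g b = g s • b := by
  unfold Dg
  rw [LinearMap.comp_apply]
  change DirectSum.toModule K (Fin n → ℤ) B (fun s => g s • (𝒜 s).subtype)
    (DirectSum.decompose 𝒜 b) = _
  rw [DirectSum.decompose_of_mem 𝒜 hb]
  exact DirectSum.toModule_lof (M := fun s => 𝒜 s) K s (⟨b, hb⟩ : 𝒜 s)

theorem Dg_inj (g : (Fin n → ℤ) → K) (hg : ∀ s, g s ≠ 0) : Function.Injective (Dg 𝒜 g) := by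
  refine Function.LeftInverse.injective (g := Dg 𝒜 (fun s => (g s)⁻¹)) fun b => ?_
  induction b using DirectSum.Decomposition.inductionOn 𝒜 with
  | zero => simp
  | @homogeneous s b =>
    rw [Dg_apply 𝒜 g b.2, map_smul, Dg_apply 𝒜 _ b.2, smul_smul, mul_inv_cancel₀ (hg s), one_smul]
  | add a b ha hb => rw [map_add, map_add, ha, hb]

/-- Scaling exponent. -/
noncomputable def gg (hn : 0 < n) (p : K) (s : Fin n → ℤ) : K :=
  p ^ (-(s (lastIdx n hn) * (s (lastIdx n hn) - 1) / 2))

theorem gg_ne (hn : 0 < n) (hp : p ≠ 0) (s : Fin n → ℤ) : gg hn p s ≠ 0 := zpow_ne_zero _ hp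

theorem gg_add (hn : 0 < n) (h : m < n) (hp : p ≠ 0) (s : Fin n → ℤ) (i : Fin m) (j : Fin (n - m)) :
    gg hn p (s + xContent m n i j) = gg hn p s * cmap K hn p s (xContent m n i j) := by
  rw [cmap_eq hn hp, x_sum hn h]
  unfold gg
  rw [← zpow_add₀ hp, Pi.add_apply, x_last hn h]
  congr 1
  generalize s (lastIdx n hn) = l
  unfold lst
  split_ifs
  · have : (l + 1) * (l + 1 - 1) = l * (l - 1) + l * 2 := by ring
    rw [this, Int.add_mul_ediv_right _ _ (by norm_num)]
    ring
  · simp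

variable {T : Type*} [Ring T] [Algebra K T]

theorem tw_mul (hn : 0 < n) (h : m < n) (hp : p ≠ 0) (tw : CocycleTwist K B 𝒜 (cmap K hn p) T)
    (i : Fin m) (j : Fin (n - m)) (x : B) (hx : x ∈ 𝒜 (xContent m n i j)) (b : B) :
    tw.τ (Dg 𝒜 (gg hn p) b) * tw.τ x = tw.τ (Dg 𝒜 (gg hn p) (b * x)) := by
  induction b using DirectSum.Decomposition.inductionOn 𝒜 with
  | zero => simp
  | @homogeneous s b =>
    rw [Dg_apply 𝒜 _ b.2, Dg_apply 𝒜 _ (SetLike.mul_mem_graded b.2 hx), map_smul, map_smul,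
      smul_mul_assoc, tw.mul_tw s _ _ _ b.2 hx, smul_smul, gg_add hn h hp]
  | add a b ha hb => rw [map_add, map_add, add_mul, ha, hb, add_mul, map_add, map_add]

theorem tw_isQMat (hn : 0 < n) (h : m < n) (hp : p ≠ 0) (tw : CocycleTwist K B 𝒜 (cmap K hn p) T)
    {x : Fin m → Fin (n - m) → B} (hx : ∀ i j, x i j ∈ 𝒜 (xContent m n i j)) (hX : IsQMat q x) :
    IsQMat q (fun i j => tw.τ (x i j)) := by
  have key : ∀ i j k l, tw.τ (x i j) * tw.τ (x k l) =
      p ^ (-(lst m n j * lst m n l)) • tw.τ (x i j * x k l) := by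
    intro i j k l
    rw [tw.mul_tw _ _ _ _ (hx i j) (hx k l), cmap_eq hn hp, x_sum hn h, x_last hn h, mul_neg]
  constructor
  · intro i j l hj
    rw [key, key, hX.row i j l hj, mul_comm (lst m n j), map_smul, smul_comm]
  · intro i k j hj
    rw [key, key, hX.col i k j hj, map_smul, smul_comm]
  · intro i k j l hk hj
    rw [key, key, hX.comm i k j l hk hj, mul_comm (lst m n j)]
  · intro i k j l hk hj
    rw [key, key, key, mul_comm (lst m n l), ← smul_sub, ← map_sub, hX.qrel i k j l hk hj, map_smul,
      smul_comm]

theorem lift_tw (hn : 0 < n) (h : m < n) (hp : p ≠ 0) (tw : CocycleTwist K B 𝒜 (cmap K hn p) T)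
    {x : Fin m → Fin (n - m) → B} (hx : ∀ i j, x i j ∈ 𝒜 (xContent m n i j)) (hX : IsQMat q x)
    (f : QMat K q m (n - m)) :
    (tw_isQMat 𝒜 hn h hp tw hx hX).lift f = tw.τ (Dg 𝒜 (gg hn p) (hX.lift f)) := by
  have h1 : tw.τ 1 = 1 := by
    have e : ∀ b, tw.τ 1 * tw.τ b = tw.τ b := by
      intro b
      induction b using DirectSum.Decomposition.inductionOn 𝒜 with
      | zero => simp
      | @homogeneous s b =>
        rw [tw.mul_tw 0 s _ _ SetLike.GradedOne.one_mem b.2, one_mul, cmap_eq hn hp]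
        simp
      | add a b ha hb => rw [map_add, mul_add, ha, hb]
    have := e (tw.τ.symm 1)
    rwa [LinearEquiv.apply_symm_apply, mul_one] at this
  induction f using QMat_induction with
  | h1 =>
    rw [map_one, map_one, Dg_apply 𝒜 _ (SetLike.GradedOne.one_mem (A := 𝒜)), map_smul, h1]
    simp [gg]
  | hadd f g hf hg => simp only [map_add, hf, hg]
  | hs c f hf => simp only [map_smul, hf]
  | hX f i j hf =>
    rw [map_mul, map_mul, IsQMat.lift_X, IsQMat.lift_X, hf, tw_mul 𝒜 hn h hp tw i j _ (hx i j)]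

theorem iso_tw (hn : 0 < n) (h : m < n) (hp : p ≠ 0) (tw : CocycleTwist K B 𝒜 (cmap K hn p) T)
    {x : Fin m → Fin (n - m) → B} (hx : ∀ i j, x i j ∈ 𝒜 (xContent m n i j)) (hX : IsQMat q x)
    (hinj : Function.Injective hX.lift) :
    ∃ iso : QMat K q m (n - m) ≃ₐ[K]
        ↥(Algebra.adjoin K (Set.range fun pr : Fin m × Fin (n - m) => tw.τ (x pr.1 pr.2))),
      ∀ (i : Fin m) (j : Fin (n - m)), (iso (X K q i j) : T) = tw.τ (x i j) := by
  set F := (tw_isQMat 𝒜 hn h hp tw hx hX).lift with hF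
  have hFi : Function.Injective F := by
    intro f g hfg
    rw [hF, lift_tw 𝒜 hn h hp tw hx hX, lift_tw 𝒜 hn h hp tw hx hX] at hfg
    exact hinj (Dg_inj 𝒜 _ (gg_ne hn hp) (tw.τ.injective hfg))
  have hr : F.range = Algebra.adjoin K
      (Set.range fun pr : Fin m × Fin (n - m) => tw.τ (x pr.1 pr.2)) := by
    rw [← Algebra.map_top, ← QMat_adjoin, AlgHom.map_adjoin, ← Set.range_comp]
    congr 2
    funext pr
    simp [hF]
  refine ⟨(AlgEquiv.ofInjective F hFi).trans (Subalgebra.equivOfEq _ _ hr), fun i j => ?_⟩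
  change F (X K q i j) = _
  rw [hF, IsQMat.lift_X]

theorem y_tw (hn : 0 < n) (h : m < n) (hq : q ≠ 0) (hp : p ≠ 0) (hpm : p ^ m = q ^ 2)
    (tw : CocycleTwist K B 𝒜 (cmap K hn p) T) (i : Fin m) (j : Fin (n - m))
    (x y : B) (hx : x ∈ 𝒜 (xContent m n i j)) (hy : y ∈ 𝒜 (yContent m n))
    (hyx : y * x = q • (x * y)) :
    ((j : ℕ) < n - m - 1 → tw.τ y * tw.τ x = q • (tw.τ x * tw.τ y)) ∧
    ((j : ℕ) = n - m - 1 → tw.τ y * tw.τ x = q⁻¹ • (tw.τ x * tw.τ y)) := by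
  rw [tw.mul_tw _ _ _ _ hy hx, tw.mul_tw _ _ _ _ hx hy, cmap_eq hn hp, cmap_eq hn hp, y_last hn h,
    y_sum hn h, x_last hn h, zero_mul, zpow_zero, one_smul, hyx, map_smul]
  constructor
  · intro hj
    rw [lst, if_neg (by omega)]
    simp
  · intro hj
    rw [lst, if_pos hj, one_mul, zpow_natCast, hpm, smul_smul]
    congr 1
    field_simp

end Tw
end QGP

namespace QG

/-- Let `A = K[x_{ij}][y^{±1};σ]` be the dehomogenisation of
`O_q(G(m,n))` at `M₁ = [1,…,m]`, graded by `ℤ^n` via content, and let `T(A)` be its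
twist by the cocycle `c` (where `p^m = q²`), with twist map `a ↦ a'`.  Then (1) the
`x'_{ij}` form a generic `q`-quantum matrix: the subalgebra they generate is isomorphic
to `O_q(M_{m,n−m})` via `x'_{ij} ↦ X_{ij}`;  and (2) `y'x'_{ij} = q x'_{ij} y'` for
`j < n−m`, while `y'x'_{i,n−m} = q⁻¹ x'_{i,n−m} y'`. -/
theorem twisted_dehomogenisation_relations
    (K : Type*) [Field K] (q : K) (hq : q ≠ 0) (hroot : ∀ k : ℕ, 0 < k → q ^ k ≠ 1)
    (m n : ℕ) (hm : 0 < m) (hmn : m < n)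
    (p : K) (hp : p ^ m = q ^ 2)
    (B : Type*) [Ring B] [Algebra K B]
    (L : NormalLoc K (↥(qGrass K q m n)) B
      (grE K q m (consecSet (show 0 < n by omega) m 0)))
    (𝒜 : (Fin n → ℤ) → Submodule K B) [GradedAlgebra 𝒜]
    (hx : ∀ (i : Fin m) (j : Fin (n - m)),
      xElt K q m n (show 0 < n by omega) 0 L i j ∈ 𝒜 (xContent m n i j))
    (hy : L.emb (grE K q m (consecSet (show 0 < n by omega) m 0)) ∈ 𝒜 (yContent m n))
    (T : Type*) [Ring T] [Algebra K T]
    (tw : CocycleTwist K B 𝒜 (cmap K (show 0 < n by omega) p) T) :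
    (∃ iso : QMat K q m (n - m) ≃ₐ[K]
        ↥(Algebra.adjoin K (Set.range fun pr : Fin m × Fin (n - m) =>
            tw.τ (xElt K q m n (show 0 < n by omega) 0 L pr.1 pr.2))),
      ∀ (i : Fin m) (j : Fin (n - m)),
        (iso (X K q i j) : T) = tw.τ (xElt K q m n (show 0 < n by omega) 0 L i j)) ∧
    (∀ (i : Fin m) (j : Fin (n - m)),
      ((j : ℕ) < n - m - 1 →
        tw.τ (L.emb (grE K q m (consecSet (show 0 < n by omega) m 0))) *
            tw.τ (xElt K q m n (show 0 < n by omega) 0 L i j) =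
          q • (tw.τ (xElt K q m n (show 0 < n by omega) 0 L i j) *
            tw.τ (L.emb (grE K q m (consecSet (show 0 < n by omega) m 0))))) ∧
      ((j : ℕ) = n - m - 1 →
        tw.τ (L.emb (grE K q m (consecSet (show 0 < n by omega) m 0))) *
            tw.τ (xElt K q m n (show 0 < n by omega) 0 L i j) =
          q⁻¹ • (tw.τ (xElt K q m n (show 0 < n by omega) 0 L i j) *
            tw.τ (L.emb (grE K q m (consecSet (show 0 < n by omega) m 0)))))) := by
  obtain ⟨t, rfl⟩ : ∃ t, m = t + 1 := ⟨m - 1, by omega⟩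
  have hn : 0 < n := by omega
  have hp0 : p ≠ 0 := by
    rintro rfl
    rw [zero_pow (by omega)] at hp
    exact pow_ne_zero 2 hq hp.symm
  refine ⟨QGP.iso_tw 𝒜 hn hmn hp0 tw hx (QGP.xElt_isQMat hmn hn L hq) (QGP.phi_inj hmn hn L hq),
    fun i j => QGP.y_tw 𝒜 hn hmn hq hp0 hp tw i j _ _ (hx i j) hy (QGP.y_x hmn hn L hq i j)⟩

end QG
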